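/- arXiv:2605.07772 — 2 statements merged into one kernel-verified Lean document; each statement's English description precedes it below -/
import Mathlib

section
/- For every γ > 0 there exists ε₀ > 0 such that for every 0 < ε < ε₀ and every global minimizer μ̄ of E_{ε,A} over Borel probability measures on S, the following two properties hold: (i) for every measurable h : S → ℝ with ∫_S h² dμ̄ < ∞ and ∫_S h dμ̄ = 0, one has ∬_{S×S} K_A(x,y) h(x) h(y) dμ̄(x) dμ̄(y) ≤ (λ_2/λ_1 + γ)·ε·∫_S h² dμ̄; and (ii) there exists a measurable h : S → ℝ with 0 < ∫_S h² dμ̄ < ∞ and ∫_S h dμ̄ = 0 such that ∬_{S×S} K_A(x,y) h(x) h(y) dμ̄(x) dμ̄(y) ≥ (λ_2/λ_1 − γ)·ε·∫_S h² dμ̄. -/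
open MeasureTheory Real Filter Topology

noncomputable section

/-- The unit sphere `S = 𝕊^{d-1}` in `ℝ^d`. -/
abbrev Sph (d : ℕ) : Type := Metric.sphere (0 : EuclideanSpace ℝ (Fin d)) 1

variable {d : ℕ}

/-- The bilinear form `⟨x, A y⟩` for the diagonal matrix `A = diag lam`. -/
def qA (lam : Fin d → ℝ) (x y : EuclideanSpace ℝ (Fin d)) : ℝ :=
  ∑ i, lam i * x i * y i

/-- The interaction kernel `K_A(x,y) = exp ⟨x, A y⟩`. -/
def Kker (lam : Fin d → ℝ) (x y : Sph d) : ℝ :=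
  Real.exp (qA lam (x : EuclideanSpace ℝ (Fin d)) (y : EuclideanSpace ℝ (Fin d)))

/-- The interaction energy `I_A(μ)`. -/
def IA (lam : Fin d → ℝ) (μ : Measure (Sph d)) : ℝ :=
  ∫ x, ∫ y, Kker lam x y ∂μ ∂μ

/-- The potential `W_μ(x) = ∫ K_A(x,y) dμ(y)`. -/
def WA (lam : Fin d → ℝ) (μ : Measure (Sph d)) (x : Sph d) : ℝ :=
  ∫ y, Kker lam x y ∂μ

open scoped Classical in
/-- Relative entropy of `μ` with respect to `ω`, with value `+∞` when `μ` is not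
absolutely continuous w.r.t. `ω` or the entropy integral diverges. -/
def Ent (ω μ : Measure (Sph d)) : EReal :=
  if μ ≪ ω ∧ Integrable (fun x => Real.log (μ.rnDeriv ω x).toReal) μ
  then ((∫ x, Real.log (μ.rnDeriv ω x).toReal ∂μ : ℝ) : EReal)
  else ⊤

/-- The free energy `E_{ε,A}(μ) = ε·Ent(μ) − (1/2)·I_A(μ)`. -/
def EA (lam : Fin d → ℝ) (ω : Measure (Sph d)) (ε : ℝ) (μ : Measure (Sph d)) : EReal :=
  (ε : EReal) * Ent ω μ - ((IA lam μ / 2 : ℝ) : EReal)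

/-- The antipodal map on the sphere. -/
def antip (x : Sph d) : Sph d :=
  ⟨-(x : EuclideanSpace ℝ (Fin d)), by
    have hx := x.2
    rw [mem_sphere_zero_iff_norm] at hx ⊢
    rwa [norm_neg]⟩

/-- The sphere self-map induced by a linear isometry equivalence of `ℝ^d`. -/
def sphMap (g : EuclideanSpace ℝ (Fin d) ≃ₗᵢ[ℝ] EuclideanSpace ℝ (Fin d)) (x : Sph d) : Sph d :=
  ⟨g (x : EuclideanSpace ℝ (Fin d)), by
    have hx := x.2
    rw [mem_sphere_zero_iff_norm] at hx ⊢
    rwa [g.norm_map]⟩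

/-- `ω` is the uniform probability measure on the sphere, characterised as a
rotation-invariant Borel probability measure. -/
def IsUniform (ω : Measure (Sph d)) : Prop :=
  IsProbabilityMeasure ω ∧
  ∀ g : EuclideanSpace ℝ (Fin d) ≃ₗᵢ[ℝ] EuclideanSpace ℝ (Fin d),
    Measure.map (sphMap g) ω = ω

/-- The (topological) support of a measure. -/
def msupport (μ : Measure (Sph d)) : Set (Sph d) :=
  {x | ∀ U : Set (Sph d), IsOpen U → x ∈ U → 0 < μ U}

/-- The set of global maximizers of the potential `W_ν`. -/
def argmaxW (lam : Fin d → ℝ) (ν : Measure (Sph d)) : Set (Sph d) :=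
  {x | ∀ y, WA lam ν y ≤ WA lam ν x}

/-- `μ` is a Gibbs critical point of `E_{ε,A}`. -/
def IsGibbs (lam : Fin d → ℝ) (ω : Measure (Sph d)) (ε : ℝ) (μ : Measure (Sph d)) : Prop :=
  IsProbabilityMeasure μ ∧
  μ = ω.withDensity (fun x => ENNReal.ofReal
    (Real.exp (WA lam μ x / ε) / ∫ z, Real.exp (WA lam μ z / ε) ∂ω))

/-- `μ` is a global minimizer of `E_{ε,A}` over Borel probability measures. -/
def IsMinimizer (lam : Fin d → ℝ) (ω : Measure (Sph d)) (ε : ℝ) (μ : Measure (Sph d)) : Prop :=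
  IsProbabilityMeasure μ ∧
  ∀ ν : Measure (Sph d), IsProbabilityMeasure ν → EA lam ω ε μ ≤ EA lam ω ε ν

/-- `m_ε`, the infimum of the free energy over probability measures. -/
def mEps (lam : Fin d → ℝ) (ω : Measure (Sph d)) (ε : ℝ) : EReal :=
  sInf {r : EReal | ∃ μ : Measure (Sph d), IsProbabilityMeasure μ ∧ EA lam ω ε μ = r}

lemma cint {X : Type*} [TopologicalSpace X] [CompactSpace X] [MeasurableSpace X]
    [OpensMeasurableSpace X] [T2Space X]
    (μ : Measure X) [IsFiniteMeasure μ] {f : X → ℝ} (hf : Continuous f) : Integrable f μ :=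
  hf.integrable_of_hasCompactSupport (HasCompactSupport.of_compactSpace f)

lemma coord_cont (i : Fin d) : Continuous (fun x : Sph d => (x : EuclideanSpace ℝ (Fin d)) i) := by
  fun_prop

lemma qA_cont (lam : Fin d → ℝ) : Continuous (fun z : Sph d × Sph d =>
    qA lam (z.1 : EuclideanSpace ℝ (Fin d)) (z.2 : EuclideanSpace ℝ (Fin d))) := by
  unfold qA; fun_prop

lemma K_cont (lam : Fin d → ℝ) : Continuous (fun z : Sph d × Sph d => Kker lam z.1 z.2) := by
  unfold Kker
  exact Real.continuous_exp.comp (qA_cont lam)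

lemma K_cont_left (lam : Fin d → ℝ) (y : Sph d) : Continuous (fun x => Kker lam x y) :=
  (K_cont lam).comp (by fun_prop : Continuous fun x : Sph d => (x, y))

lemma K_cont_right (lam : Fin d → ℝ) (x : Sph d) : Continuous (fun y => Kker lam x y) :=
  (K_cont lam).comp (by fun_prop : Continuous fun y : Sph d => (x, y))

lemma K_symm (lam : Fin d → ℝ) (x y : Sph d) : Kker lam x y = Kker lam y x := by
  unfold Kker qA
  congr 1
  exact Finset.sum_congr rfl fun i _ => by ring

lemma param_cont (μ : Measure (Sph d)) [IsFiniteMeasure μ] {F : Sph d → Sph d → ℝ}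
    (hF : Continuous (fun z : Sph d × Sph d => F z.1 z.2)) :
    Continuous (fun x => ∫ y, F x y ∂μ) := by
  obtain ⟨C, hC⟩ := (isCompact_univ.image hF).isBounded.exists_norm_le
  refine continuous_of_dominated (bound := fun _ => C) ?_ ?_ (integrable_const _) ?_
  · intro x
    exact (hF.comp (by fun_prop : Continuous fun y : Sph d => (x, y))).aestronglyMeasurable
  · intro x
    exact Eventually.of_forall fun y => hC _ ⟨(x, y), trivial, rfl⟩
  · exact Eventually.of_forall fun y => hF.comp (by fun_prop : Continuous fun x : Sph d => (x, y))

lemma W_cont (lam : Fin d → ℝ) (μ : Measure (Sph d)) [IsFiniteMeasure μ] :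
    Continuous (WA lam μ) := param_cont μ (K_cont lam)

/-- real-valued entropy finite -/
def EntFin (ω μ : Measure (Sph d)) : Prop := μ ≪ ω ∧ Integrable (llr μ ω) μ

lemma EA_fin (lam : Fin d → ℝ) (ω : Measure (Sph d)) (ε : ℝ) (μ : Measure (Sph d))
    (h : EntFin ω μ) :
    EA lam ω ε μ = ((ε * (∫ x, llr μ ω x ∂μ) - IA lam μ / 2 : ℝ) : EReal) := by
  unfold EA Ent
  rw [if_pos (by simpa [EntFin, llr_def] using h)]
  rw [EReal.coe_sub, EReal.coe_mul]
  rfl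

lemma EA_top (lam : Fin d → ℝ) (ω : Measure (Sph d)) {ε : ℝ} (hε : 0 < ε) (μ : Measure (Sph d))
    (h : ¬ EntFin ω μ) : EA lam ω ε μ = ⊤ := by
  unfold EA Ent
  rw [if_neg (by simpa [EntFin, llr_def] using h), EReal.coe_mul_top_of_pos hε]
  exact EReal.top_sub_coe _

lemma entfin_self (ω : Measure (Sph d)) [IsProbabilityMeasure ω] : EntFin ω ω := by
  refine ⟨Measure.AbsolutelyContinuous.rfl, ?_⟩
  rw [integrable_congr (llr_self ω)]
  exact integrable_zero _ _ _

lemma min_entfin {lam : Fin d → ℝ} {ω : Measure (Sph d)} [IsProbabilityMeasure ω] {ε : ℝ}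
    (hε : 0 < ε) {μ : Measure (Sph d)} (h : IsMinimizer lam ω ε μ) : EntFin ω μ := by
  by_contra hc
  have := h.2 ω inferInstance
  rw [EA_top lam ω hε μ hc, EA_fin lam ω ε ω (entfin_self ω), top_le_iff] at this
  exact EReal.coe_ne_top _ this

lemma min_le {lam : Fin d → ℝ} {ω : Measure (Sph d)} [IsProbabilityMeasure ω] {ε : ℝ}
    (hε : 0 < ε) {μ : Measure (Sph d)} (h : IsMinimizer lam ω ε μ) {ν : Measure (Sph d)}
    [IsProbabilityMeasure ν] (hν : EntFin ω ν) :
    ε * (∫ x, llr μ ω x ∂μ) - IA lam μ / 2 ≤ ε * (∫ x, llr ν ω x ∂ν) - IA lam ν / 2 := by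
  have := h.2 ν inferInstance
  rwa [EA_fin lam ω ε μ (min_entfin hε h), EA_fin lam ω ε ν hν, EReal.coe_le_coe_iff] at this

lemma ent_nonneg {ω μ : Measure (Sph d)} [IsProbabilityMeasure ω] [IsProbabilityMeasure μ]
    (h : EntFin ω μ) : 0 ≤ ∫ x, llr μ ω x ∂μ := by
  have := InformationTheory.integral_llr_add_sub_measure_univ_nonneg h.1 h.2
  simpa using this

/-- mixture -/
def mix (t : ℝ) (μ ν : Measure (Sph d)) : Measure (Sph d) :=
  ENNReal.ofReal (1 - t) • μ + ENNReal.ofReal t • ν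

lemma mix_prob {t : ℝ} (h0 : 0 ≤ t) (h1 : t ≤ 1) (μ ν : Measure (Sph d)) [IsProbabilityMeasure μ]
    [IsProbabilityMeasure ν] : IsProbabilityMeasure (mix t μ ν) := by
  constructor
  simp only [mix, Measure.add_apply, Measure.smul_apply, measure_univ, smul_eq_mul, mul_one]
  rw [← ENNReal.ofReal_add (by linarith) h0]; simp

lemma mix_integral {t : ℝ} (h0 : 0 ≤ t) (h1 : t ≤ 1) (μ ν : Measure (Sph d))
    {f : Sph d → ℝ} (hfμ : Integrable f μ) (hfν : Integrable f ν) :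
    ∫ x, f x ∂(mix t μ ν) = (1 - t) * ∫ x, f x ∂μ + t * ∫ x, f x ∂ν := by
  unfold mix
  rw [integral_add_measure (hfμ.smul_measure ENNReal.ofReal_ne_top)
    (hfν.smul_measure ENNReal.ofReal_ne_top), integral_smul_measure, integral_smul_measure,
    ENNReal.toReal_ofReal (by linarith), ENNReal.toReal_ofReal h0]
  simp

lemma mix_ent {t : ℝ} (h0 : 0 ≤ t) (h1 : t ≤ 1) {ω μ ν : Measure (Sph d)}
    [IsProbabilityMeasure ω] [IsProbabilityMeasure μ]
    [IsProbabilityMeasure ν] (hμ : EntFin ω μ) (hν : EntFin ω ν) :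
    EntFin ω (mix t μ ν) ∧ ∫ x, llr (mix t μ ν) ω x ∂(mix t μ ν) ≤
      (1 - t) * ∫ x, llr μ ω x ∂μ + t * ∫ x, llr ν ω x ∂ν := by
  have := mix_prob h0 h1 μ ν
  have hac : mix t μ ν ≪ ω := by
    unfold mix
    exact Measure.AbsolutelyContinuous.add_left (hμ.1.smul_left _) (hν.1.smul_left _)
  have hrn : (fun x => ((mix t μ ν).rnDeriv ω x).toReal) =ᵐ[ω]
      fun x => (1 - t) * (μ.rnDeriv ω x).toReal + t * (ν.rnDeriv ω x).toReal := by
    haveI : IsFiniteMeasure (ENNReal.ofReal (1 - t) • μ) :=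
      Measure.smul_finite μ ENNReal.ofReal_ne_top
    haveI : IsFiniteMeasure (ENNReal.ofReal t • ν) := Measure.smul_finite ν ENNReal.ofReal_ne_top
    have e1 := Measure.rnDeriv_add' (ENNReal.ofReal (1 - t) • μ) (ENNReal.ofReal t • ν) ω
    have e2 := Measure.rnDeriv_smul_left_of_ne_top' (ν := μ) (μ := ω) (r := ENNReal.ofReal (1 - t)) ENNReal.ofReal_ne_top
    have e3 := Measure.rnDeriv_smul_left_of_ne_top' (ν := ν) (μ := ω) (r := ENNReal.ofReal t) ENNReal.ofReal_ne_top
    filter_upwards [e1, e2, e3, Measure.rnDeriv_lt_top μ ω, Measure.rnDeriv_lt_top ν ω]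
      with x h1' h2 h3 h4 h5
    unfold mix
    rw [h1', Pi.add_apply, h2, h3, Pi.smul_apply, Pi.smul_apply, smul_eq_mul, smul_eq_mul,
      ENNReal.toReal_add (ENNReal.mul_ne_top ENNReal.ofReal_ne_top h4.ne)
        (ENNReal.mul_ne_top ENNReal.ofReal_ne_top h5.ne), ENNReal.toReal_mul, ENNReal.toReal_mul,
      ENNReal.toReal_ofReal (by linarith), ENNReal.toReal_ofReal h0]
  have iμ := (InformationTheory.integrable_klFun_rnDeriv_iff hμ.1).2 hμ.2
  have iν := (InformationTheory.integrable_klFun_rnDeriv_iff hν.1).2 hν.2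
  have hle : ∀ᵐ x ∂ω, InformationTheory.klFun (((mix t μ ν).rnDeriv ω x).toReal) ≤
      (1 - t) * InformationTheory.klFun ((μ.rnDeriv ω x).toReal) +
        t * InformationTheory.klFun ((ν.rnDeriv ω x).toReal) := by
    filter_upwards [hrn] with x hx
    rw [hx]
    exact InformationTheory.convexOn_klFun.2 (Set.mem_Ici.2 ENNReal.toReal_nonneg)
      (Set.mem_Ici.2 ENNReal.toReal_nonneg) (by linarith) h0 (by ring)
  have iR := (iμ.const_mul (1 - t)).add (iν.const_mul t)
  have iM : Integrable (fun x => InformationTheory.klFun (((mix t μ ν).rnDeriv ω x).toReal)) ω := by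
    refine iR.mono' ?_ ?_
    · exact (InformationTheory.measurable_klFun.comp
        (Measure.measurable_rnDeriv _ _).ennreal_toReal).aestronglyMeasurable
    · filter_upwards [hle] with x hx
      rw [Real.norm_of_nonneg (InformationTheory.klFun_nonneg ENNReal.toReal_nonneg)]
      exact hx
  have hM : EntFin ω (mix t μ ν) := ⟨hac, (InformationTheory.integrable_klFun_rnDeriv_iff hac).1 iM⟩
  refine ⟨hM, ?_⟩
  have k1 := InformationTheory.integral_klFun_rnDeriv hM.1 hM.2
  have k2 := InformationTheory.integral_klFun_rnDeriv hμ.1 hμ.2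
  have k3 := InformationTheory.integral_klFun_rnDeriv hν.1 hν.2
  simp only [probReal_univ, add_sub_cancel_right] at k1 k2 k3
  rw [← k1, ← k2, ← k3]
  calc _ ≤ ∫ x, ((1 - t) * InformationTheory.klFun ((μ.rnDeriv ω x).toReal) +
        t * InformationTheory.klFun ((ν.rnDeriv ω x).toReal)) ∂ω := integral_mono_ae iM iR hle
    _ = _ := by
      rw [integral_add (iμ.const_mul (1 - t)) (iν.const_mul t), integral_const_mul,
        integral_const_mul]

lemma mix_IA {t : ℝ} (h0 : 0 ≤ t) (h1 : t ≤ 1) (lam : Fin d → ℝ) (μ ν : Measure (Sph d))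
    [IsProbabilityMeasure μ] [IsProbabilityMeasure ν] :
    IA lam (mix t μ ν) = (1 - t) ^ 2 * IA lam μ + 2 * t * (1 - t) * ∫ x, WA lam μ x ∂ν
      + t ^ 2 * IA lam ν := by
  have hin : ∀ x, ∫ y, Kker lam x y ∂(mix t μ ν) = (1 - t) * WA lam μ x + t * WA lam ν x :=
    fun x => mix_integral h0 h1 μ ν (cint _ (K_cont_right lam x)) (cint _ (K_cont_right lam x))
  have hc1 := W_cont lam μ
  have hc2 := W_cont lam ν
  have hsw : ∫ x, WA lam ν x ∂μ = ∫ x, WA lam μ x ∂ν := by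
    unfold WA
    rw [integral_integral_swap (f := fun x y => Kker lam x y) (cint _ (K_cont lam))]
    simp_rw [K_symm lam]
  unfold IA
  simp_rw [hin]
  have hs : ∀ σ : Measure (Sph d), IsProbabilityMeasure σ →
      ∫ x, ((1 - t) * WA lam μ x + t * WA lam ν x) ∂σ =
      (1 - t) * ∫ x, WA lam μ x ∂σ + t * ∫ x, WA lam ν x ∂σ := by
    intro σ _
    rw [integral_add ((cint _ hc1).const_mul _) ((cint _ hc2).const_mul _), integral_const_mul,
      integral_const_mul]
  have hc3 : Continuous fun x => (1 - t) * WA lam μ x + t * WA lam ν x := by fun_prop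
  rw [mix_integral h0 h1 μ ν (cint _ hc3) (cint _ hc3), hs μ inferInstance, hs ν inferInstance, hsw]
  unfold WA
  ring

lemma min_first {lam : Fin d → ℝ} {ω : Measure (Sph d)} [IsProbabilityMeasure ω] {ε : ℝ}
    (hε : 0 < ε) {μ : Measure (Sph d)} (h : IsMinimizer lam ω ε μ) {ν : Measure (Sph d)}
    [IsProbabilityMeasure ν] (hν : EntFin ω ν) :
    ε * (∫ x, llr μ ω x ∂μ) - ∫ x, WA lam μ x ∂μ ≤ ε * (∫ x, llr ν ω x ∂ν) - ∫ x, WA lam μ x ∂ν := by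
  have := h.1
  have hμ := min_entfin hε h
  have hI : IA lam μ = ∫ x, WA lam μ x ∂μ := rfl
  set Hμ := ∫ x, llr μ ω x ∂μ
  set Hν := ∫ x, llr ν ω x ∂ν
  set J := ∫ x, WA lam μ x ∂ν
  rw [← hI]
  have key : ∀ t : ℝ, 0 < t → t < 1 → 0 ≤ ε * (Hν - Hμ) + (2 - t) / 2 * IA lam μ - (1 - t) * J
      - t / 2 * IA lam ν := by
    intro t h0 h1
    have := mix_prob h0.le h1.le μ ν
    obtain ⟨e1, e2⟩ := mix_ent h0.le h1.le hμ hν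
    have e3 := min_le hε h e1
    rw [mix_IA h0.le h1.le] at e3
    have e4 := mul_le_mul_of_nonneg_left e2 hε.le
    have : 0 ≤ t * (ε * (Hν - Hμ) + (2 - t) / 2 * IA lam μ - (1 - t) * J - t / 2 * IA lam ν) := by
      nlinarith [e3, e4]
    exact nonneg_of_mul_nonneg_right this h0
  have hlim : Tendsto (fun t : ℝ => ε * (Hν - Hμ) + (2 - t) / 2 * IA lam μ - (1 - t) * J
      - t / 2 * IA lam ν) (𝓝[>] 0) (𝓝 (ε * (Hν - Hμ) + (2 - 0) / 2 * IA lam μ - (1 - 0) * J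
      - 0 / 2 * IA lam ν)) := by
    refine Tendsto.mono_left (Continuous.tendsto ?_ 0) nhdsWithin_le_nhds
    fun_prop
  have := ge_of_tendsto hlim (by
    filter_upwards [Ioo_mem_nhdsGT (show (0:ℝ) < 1 by norm_num)] with t ht
    exact key t ht.1 ht.2)
  linarith

theorem min_gibbs {lam : Fin d → ℝ} {ω : Measure (Sph d)} [IsProbabilityMeasure ω] {ε : ℝ}
    (hε : 0 < ε) {μ : Measure (Sph d)} (h : IsMinimizer lam ω ε μ) :
    μ = ω.tilted (fun x => WA lam μ x / ε) := by
  have := h.1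
  have hμ := min_entfin hε h
  set f : Sph d → ℝ := fun x => WA lam μ x / ε with hf
  have hfc : Continuous f := (W_cont lam μ).div_const ε
  have hei : Integrable (fun x => exp (f x)) ω := cint _ (Real.continuous_exp.comp hfc)
  have hp : IsProbabilityMeasure (ω.tilted f) := isProbabilityMeasure_tilted hei
  set ν := ω.tilted f with hνd
  have hac : ν ≪ ω := tilted_absolutelyContinuous _ _
  have hllr : llr ν ω =ᵐ[ν] fun x => f x - log (∫ z, exp (f z) ∂ω) := by
    have := llr_tilted_left (μ := ω) (ν := ω) Measure.AbsolutelyContinuous.rfl hei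
      hfc.measurable.aemeasurable
    filter_upwards [hac.ae_le this, hac.ae_le (llr_self ω)] with x h1 h2
    rw [h1, h2]; simp
  have hνf : EntFin ω ν := by
    refine ⟨hac, ?_⟩
    rw [integrable_congr hllr]
    exact (cint _ hfc).sub (integrable_const _)
  have hHν : ∫ x, llr ν ω x ∂ν = ∫ x, f x ∂ν - log (∫ z, exp (f z) ∂ω) := by
    rw [integral_congr_ae hllr, integral_sub (cint _ hfc) (integrable_const _)]
    simp
  have hKL := integral_llr_tilted_right hμ.1 (cint _ hfc) hei hμ.2
  have hfirst := min_first hε h hνf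
  have hW : ∀ σ : Measure (Sph d), ∫ x, WA lam μ x ∂σ = ε * ∫ x, f x ∂σ := by
    intro σ
    rw [hf, integral_div]; field_simp
  rw [hW, hW, ← mul_sub, ← mul_sub, hHν] at hfirst
  have hfirst := le_of_mul_le_mul_left hfirst hε
  have hle : ∫ x, llr μ ν x ∂μ ≤ 0 := by rw [hKL]; linarith
  have hμν : μ ≪ ν := hμ.1.trans (absolutelyContinuous_tilted hei)
  have hint : Integrable (llr μ ν) μ := integrable_llr_tilted_right hμ.1 (cint _ hfc) hμ.2 hei
  have : InformationTheory.klDiv μ ν = 0 := by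
    rw [InformationTheory.klDiv_of_ac_of_integrable hμν hint]
    simpa using hle
  exact InformationTheory.klDiv_eq_zero_iff.1 this

/-- signed first coordinate -/
def aa (s : ℝ) (i0 : Fin d) (x : Sph d) : ℝ := s * (x : EuclideanSpace ℝ (Fin d)) i0

/-- distance to the pole -/
def rr (s : ℝ) (i0 : Fin d) (x : Sph d) : ℝ := Real.sqrt (2 * (1 - aa s i0 x))

/-- transversal bilinear form -/
def zz (lam : Fin d → ℝ) (i0 : Fin d) (x y : Sph d) : ℝ :=
  ∑ i ∈ Finset.univ.erase i0,
    lam i * (x : EuclideanSpace ℝ (Fin d)) i * (y : EuclideanSpace ℝ (Fin d)) i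

lemma aa_cont (s : ℝ) (i0 : Fin d) : Continuous (aa s i0) := by
  unfold aa; fun_prop

lemma rr_cont (s : ℝ) (i0 : Fin d) : Continuous (rr s i0) := by
  unfold rr
  have := aa_cont s i0
  fun_prop

lemma sum_sq (x : Sph d) : ∑ i, (x : EuclideanSpace ℝ (Fin d)) i ^ 2 = 1 := by
  have hx := x.2
  rw [mem_sphere_zero_iff_norm] at hx
  have := EuclideanSpace.real_norm_sq_eq (x : EuclideanSpace ℝ (Fin d))
  rw [hx] at this
  linarith

lemma sum_sq_erase {s : ℝ} (hs : s ^ 2 = 1) (i0 : Fin d) (x : Sph d) :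
    ∑ i ∈ Finset.univ.erase i0, (x : EuclideanSpace ℝ (Fin d)) i ^ 2 = 1 - aa s i0 x ^ 2 := by
  have h1 := sum_sq x
  rw [← Finset.add_sum_erase _ _ (Finset.mem_univ i0)] at h1
  have : aa s i0 x ^ 2 = (x : EuclideanSpace ℝ (Fin d)) i0 ^ 2 := by
    unfold aa; rw [mul_pow, hs, one_mul]
  linarith

lemma aa_abs {s : ℝ} (hs : s ^ 2 = 1) (i0 : Fin d) (x : Sph d) : |aa s i0 x| ≤ 1 := by
  have h := sum_sq_erase hs i0 x
  have h2 : 0 ≤ ∑ i ∈ Finset.univ.erase i0, (x : EuclideanSpace ℝ (Fin d)) i ^ 2 :=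
    Finset.sum_nonneg fun i _ => sq_nonneg _
  rw [← sq_le_one_iff_abs_le_one]; linarith

lemma coord_abs (i : Fin d) (x : Sph d) : |(x : EuclideanSpace ℝ (Fin d)) i| ≤ 1 := by
  have := aa_abs (s := 1) (by norm_num) i x
  simpa [aa] using this

lemma rr_sq {s : ℝ} (hs : s ^ 2 = 1) (i0 : Fin d) (x : Sph d) :
    rr s i0 x ^ 2 = 2 * (1 - aa s i0 x) := by
  have := (abs_le.1 (aa_abs hs i0 x)).2
  exact Real.sq_sqrt (by linarith)

lemma rr_nonneg (s : ℝ) (i0 : Fin d) (x : Sph d) : 0 ≤ rr s i0 x := Real.sqrt_nonneg _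

lemma rr_le_two {s : ℝ} (hs : s ^ 2 = 1) (i0 : Fin d) (x : Sph d) : rr s i0 x ≤ 2 := by
  have h1 := rr_sq hs i0 x
  have := (abs_le.1 (aa_abs hs i0 x)).1
  nlinarith [rr_nonneg s i0 x]

lemma aa_eq {s : ℝ} (hs : s ^ 2 = 1) (i0 : Fin d) (x : Sph d) :
    aa s i0 x = 1 - rr s i0 x ^ 2 / 2 := by
  rw [rr_sq hs]; ring

lemma sum_erase_eq {s : ℝ} (hs : s ^ 2 = 1) (i0 : Fin d) (x : Sph d) :
    ∑ i ∈ Finset.univ.erase i0, (x : EuclideanSpace ℝ (Fin d)) i ^ 2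
      = rr s i0 x ^ 2 - rr s i0 x ^ 4 / 4 := by
  rw [sum_sq_erase hs, aa_eq hs]; ring

lemma sum_erase_le {s : ℝ} (hs : s ^ 2 = 1) (i0 : Fin d) (x : Sph d) :
    ∑ i ∈ Finset.univ.erase i0, (x : EuclideanSpace ℝ (Fin d)) i ^ 2 ≤ rr s i0 x ^ 2 := by
  rw [sum_erase_eq hs]
  have : 0 ≤ rr s i0 x ^ 4 := by positivity
  linarith

lemma coord_le_rr {s : ℝ} (hs : s ^ 2 = 1) (i0 : Fin d) {i : Fin d} (hi : i ≠ i0) (x : Sph d) :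
    |(x : EuclideanSpace ℝ (Fin d)) i| ≤ rr s i0 x := by
  apply abs_le_of_sq_le_sq _ (rr_nonneg s i0 x)
  refine le_trans ?_ (sum_erase_le hs i0 x)
  exact Finset.single_le_sum (f := fun i => (x : EuclideanSpace ℝ (Fin d)) i ^ 2)
    (fun i _ => sq_nonneg _) (by simp [hi])

lemma zz_abs {lam : Fin d → ℝ} {i0 : Fin d} (hpos : ∀ i, 0 < lam i) (hle : ∀ i, lam i ≤ lam i0)
    {s : ℝ} (hs : s ^ 2 = 1) (x y : Sph d) :
    |zz lam i0 x y| ≤ lam i0 * (rr s i0 x * rr s i0 y) := by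
  have h1 : |zz lam i0 x y| ≤ ∑ i ∈ Finset.univ.erase i0,
      lam i0 * (|(x : EuclideanSpace ℝ (Fin d)) i| * |(y : EuclideanSpace ℝ (Fin d)) i|) := by
    unfold zz
    refine (Finset.abs_sum_le_sum_abs _ _).trans (Finset.sum_le_sum fun i _ => ?_)
    rw [abs_mul, abs_mul, abs_of_pos (hpos i), mul_assoc]
    exact mul_le_mul_of_nonneg_right (hle i) (by positivity)
  refine h1.trans ?_
  rw [← Finset.mul_sum]
  refine mul_le_mul_of_nonneg_left ?_ (hpos i0).le
  refine (Real.sum_mul_le_sqrt_mul_sqrt _ _ _).trans ?_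
  simp only [sq_abs]
  refine mul_le_mul ?_ ?_ (Real.sqrt_nonneg _) (rr_nonneg _ _ _)
  · exact Real.sqrt_le_iff.2 ⟨rr_nonneg _ _ _, sum_erase_le hs i0 x⟩
  · exact Real.sqrt_le_iff.2 ⟨rr_nonneg _ _ _, sum_erase_le hs i0 y⟩

lemma qA_eq (lam : Fin d → ℝ) {s : ℝ} (hs : s ^ 2 = 1) (i0 : Fin d) (x y : Sph d) :
    qA lam (x : EuclideanSpace ℝ (Fin d)) (y : EuclideanSpace ℝ (Fin d))
      = lam i0 * (aa s i0 x * aa s i0 y) + zz lam i0 x y := by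
  unfold qA zz aa
  rw [← Finset.add_sum_erase _ _ (Finset.mem_univ i0)]
  congr 1
  linear_combination (-(lam i0 * (x : EuclideanSpace ℝ (Fin d)) i0 *
    (y : EuclideanSpace ℝ (Fin d)) i0)) * hs

lemma qA_abs {lam : Fin d → ℝ} {i0 : Fin d} (hpos : ∀ i, 0 < lam i) (hle : ∀ i, lam i ≤ lam i0)
    (x y : Sph d) :
    |qA lam (x : EuclideanSpace ℝ (Fin d)) (y : EuclideanSpace ℝ (Fin d))| ≤ lam i0 := by
  have h1 : |qA lam (x : EuclideanSpace ℝ (Fin d)) (y : EuclideanSpace ℝ (Fin d))| ≤ ∑ i,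
      lam i0 * (|(x : EuclideanSpace ℝ (Fin d)) i| * |(y : EuclideanSpace ℝ (Fin d)) i|) := by
    unfold qA
    refine (Finset.abs_sum_le_sum_abs _ _).trans (Finset.sum_le_sum fun i _ => ?_)
    rw [abs_mul, abs_mul, abs_of_pos (hpos i), mul_assoc]
    exact mul_le_mul_of_nonneg_right (hle i) (by positivity)
  refine h1.trans ?_
  rw [← Finset.mul_sum]
  have : ∑ i, |(x : EuclideanSpace ℝ (Fin d)) i| * |(y : EuclideanSpace ℝ (Fin d)) i| ≤ 1 := by
    refine (Real.sum_mul_le_sqrt_mul_sqrt _ _ _).trans ?_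
    simp only [sq_abs, sum_sq]
    simp
  nlinarith [hpos i0]

lemma exp_lip {A B L : ℝ} (hA : A ≤ L) (hB : B ≤ L) : |exp A - exp B| ≤ exp L * |A - B| := by
  have key : ∀ A B : ℝ, A ≤ L → B ≤ A → |exp A - exp B| ≤ exp L * |A - B| := by
    intro A B hA hAB
    rw [abs_of_nonneg (by linarith [exp_le_exp.2 hAB]), abs_of_nonneg (by linarith)]
    have h1 : exp B = exp A * exp (B - A) := by rw [← exp_add]; ring_nf
    have h2 := add_one_le_exp (B - A)
    have h3 := exp_le_exp.2 hA
    have h4 := exp_pos A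
    nlinarith [mul_le_mul_of_nonneg_left h2 h4.le, mul_le_mul_of_nonneg_right h3 (by linarith : 0 ≤ A - B)]
  rcases le_total B A with h | h
  · exact key A B hA h
  · rw [abs_sub_comm, abs_sub_comm A B]; exact key B A hB h

lemma K_le {lam : Fin d → ℝ} {i0 : Fin d} (hpos : ∀ i, 0 < lam i) (hle : ∀ i, lam i ≤ lam i0)
    (x y : Sph d) : Kker lam x y ≤ exp (lam i0) :=
  exp_le_exp.2 (abs_le.1 (qA_abs hpos hle x y)).2

/-- `K` against the one-sided limit. -/
lemma K_near {lam : Fin d → ℝ} {i0 : Fin d} (hpos : ∀ i, 0 < lam i) (hle : ∀ i, lam i ≤ lam i0)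
    {s : ℝ} (hs : s ^ 2 = 1) (x y : Sph d) :
    |Kker lam x y - exp (lam i0 * aa s i0 x)| ≤ exp (lam i0) * (3 * lam i0 * rr s i0 y) := by
  have hL := hpos i0
  have ha := abs_le.1 (aa_abs hs i0 x)
  refine (exp_lip (L := lam i0) (abs_le.1 (qA_abs hpos hle x y)).2 (by nlinarith)).trans ?_
  refine mul_le_mul_of_nonneg_left ?_ (exp_pos _).le
  rw [qA_eq lam hs i0]
  have h1 := zz_abs hpos hle hs x y
  have h2 := rr_le_two hs i0 x
  have h3 := rr_le_two hs i0 y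
  have h4 := rr_nonneg s i0 y
  have h5 : |lam i0 * (aa s i0 x * aa s i0 y) - lam i0 * aa s i0 x| ≤ lam i0 * rr s i0 y := by
    rw [show lam i0 * (aa s i0 x * aa s i0 y) - lam i0 * aa s i0 x
      = lam i0 * (aa s i0 x * (aa s i0 y - 1)) by ring, abs_mul, abs_of_pos hL]
    refine mul_le_mul_of_nonneg_left ?_ hL.le
    rw [abs_mul]
    have h6 : |aa s i0 y - 1| ≤ rr s i0 y := by
      rw [aa_eq hs, abs_le]; constructor <;> nlinarith
    calc _ ≤ 1 * |aa s i0 y - 1| := mul_le_mul_of_nonneg_right (aa_abs hs i0 x) (abs_nonneg _)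
      _ ≤ _ := by linarith
  have h7 : lam i0 * (rr s i0 x * rr s i0 y) ≤ 2 * lam i0 * rr s i0 y := by
    have := mul_le_mul_of_nonneg_right h2 h4
    nlinarith
  calc _ = |(lam i0 * (aa s i0 x * aa s i0 y) - lam i0 * aa s i0 x) + zz lam i0 x y| := by ring_nf
    _ ≤ _ := (abs_add_le _ _).trans (by linarith)

/-- open sets have positive uniform measure -/
lemma unif_open_pos {ω : Measure (Sph d)} (hω : IsUniform ω) {U : Set (Sph d)} (hU : IsOpen U)
    (hne : U.Nonempty) : 0 < ω U := by
  have := hω.1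
  obtain ⟨p, hp⟩ := hne
  rw [pos_iff_ne_zero]
  intro h0
  have hcont : ∀ g : EuclideanSpace ℝ (Fin d) ≃ₗᵢ[ℝ] EuclideanSpace ℝ (Fin d),
      Continuous (sphMap g) := fun g => by
    unfold sphMap
    exact Continuous.subtype_mk (g.continuous.comp continuous_subtype_val) _
  have hloc : ∀ x : Sph d, ∃ V : Set (Sph d), IsOpen V ∧ x ∈ V ∧ ω V = 0 := by
    intro x
    have hx := x.2
    have hp' := p.2
    rw [mem_sphere_zero_iff_norm] at hx hp'
    let g : EuclideanSpace ℝ (Fin d) ≃ₗᵢ[ℝ] EuclideanSpace ℝ (Fin d) :=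
      (Submodule.reflection (Submodule.span ℝ {(x : EuclideanSpace ℝ (Fin d)) - p})ᗮ)
    refine ⟨sphMap g ⁻¹' U, hU.preimage (hcont g), ?_, ?_⟩
    · have : sphMap g x = p := by
        apply Subtype.ext
        exact Submodule.reflection_sub (hx.trans hp'.symm)
      rw [Set.mem_preimage, this]; exact hp
    · rw [← Measure.map_apply (hcont g).measurable hU.measurableSet, hω.2 g, h0]
  choose V hVo hxV hV0 using hloc
  have : ω Set.univ = 0 := by
    obtain ⟨t, ht⟩ := isCompact_univ.elim_finite_subcover V hVo
      (fun x _ => Set.mem_iUnion.2 ⟨x, hxV x⟩)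
    refine measure_mono_null ht ?_
    exact (measure_biUnion_null_iff t.countable_toSet).2 fun x _ => hV0 x
  simp at this

/-- comparison with a normalized cap -/
lemma cap_compare {lam : Fin d → ℝ} {ω : Measure (Sph d)} [IsProbabilityMeasure ω]
    {U : Set (Sph d)} (hU : IsOpen U) (hUpos : 0 < ω U) {c : ℝ}
    (hc : ∀ x ∈ U, ∀ y ∈ U, c ≤ Kker lam x y) {ε : ℝ} (hε : 0 < ε) {μ : Measure (Sph d)}
    (h : IsMinimizer lam ω ε μ) : c + 2 * ε * log (ω.real U) ≤ IA lam μ := by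
  have := h.1
  have hν : IsProbabilityMeasure (ProbabilityTheory.cond ω U) :=
    ProbabilityTheory.cond_isProbabilityMeasure hUpos.ne'
  set ν := ProbabilityTheory.cond ω U with hνd
  have hac : ν ≪ ω := ProbabilityTheory.cond_absolutelyContinuous
  have hinU : ∀ᵐ x ∂ν, x ∈ U := ProbabilityTheory.ae_cond_mem hU.measurableSet
  have hden : ν = ω.withDensity (U.indicator fun _ => (ω U)⁻¹) := by
    rw [withDensity_indicator hU.measurableSet, withDensity_const]; rfl
  have hllr : llr ν ω =ᵐ[ν] fun x => - log (ω.real U) := by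
    have h1 : ν.rnDeriv ω =ᵐ[ω] U.indicator fun _ => (ω U)⁻¹ := by
      rw [hden]
      exact Measure.rnDeriv_withDensity ω (measurable_const.indicator hU.measurableSet)
    filter_upwards [hac.ae_le h1, hinU] with x hx hxU
    rw [llr, hx, Set.indicator_of_mem hxU, ENNReal.toReal_inv, Real.log_inv]; rfl
  have hfin : EntFin ω ν := ⟨hac, by rw [integrable_congr hllr]; exact integrable_const _⟩
  have hH : ∫ x, llr ν ω x ∂ν = - log (ω.real U) := by
    rw [integral_congr_ae hllr]; simp
  have hI : c ≤ IA lam ν := by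
    have h1 : ∀ᵐ x ∂ν, c ≤ WA lam ν x := by
      filter_upwards [hinU] with x hx
      calc c = ∫ y, c ∂ν := by simp
        _ ≤ _ := integral_mono_ae (integrable_const _) (cint _ (K_cont_right lam x)) (by
          filter_upwards [hinU] with y hy; exact hc x hx y hy)
    calc c = ∫ y, c ∂ν := by simp
      _ ≤ ∫ x, WA lam ν x ∂ν := integral_mono_ae (integrable_const _) (cint _ (W_cont lam ν)) h1
      _ = _ := rfl
  have hmin := min_le hε h hfin
  have h0 := ent_nonneg (min_entfin hε h)
  rw [hH] at hmin
  have := mul_nonneg hε.le h0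
  linarith

lemma double_qA (lam : Fin d → ℝ) (μ : Measure (Sph d)) [IsProbabilityMeasure μ] :
    ∫ x, ∫ y, qA lam (x : EuclideanSpace ℝ (Fin d)) (y : EuclideanSpace ℝ (Fin d)) ∂μ ∂μ
      = ∑ i, lam i * (∫ x : Sph d, (x : EuclideanSpace ℝ (Fin d)) i ∂μ) ^ 2 := by
  unfold qA
  have h1 : ∀ x : Sph d, ∫ y : Sph d, ∑ i, lam i * (x : EuclideanSpace ℝ (Fin d)) i *
      (y : EuclideanSpace ℝ (Fin d)) i ∂μ = ∑ i, lam i * (x : EuclideanSpace ℝ (Fin d)) i *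
      ∫ y : Sph d, (y : EuclideanSpace ℝ (Fin d)) i ∂μ := by
    intro x
    rw [integral_finsetSum _ (fun i _ => (cint μ (coord_cont i)).const_mul _)]
    exact Finset.sum_congr rfl fun i _ => integral_const_mul _ _
  simp_rw [h1]
  rw [integral_finsetSum _ (fun i _ => ((cint μ (coord_cont i)).const_mul _).mul_const _)]
  refine Finset.sum_congr rfl fun i _ => ?_
  rw [integral_mul_const, integral_const_mul]; ring

lemma mean_sq_le (μ : Measure (Sph d)) [IsProbabilityMeasure μ] {f : Sph d → ℝ}
    (hf : Continuous f) : (∫ x, f x ∂μ) ^ 2 ≤ ∫ x, f x ^ 2 ∂μ := by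
  set m := ∫ x, f x ∂μ with hm
  have h : 0 ≤ ∫ x, (f x - m) ^ 2 ∂μ := integral_nonneg fun x => sq_nonneg _
  have h2 : ∫ x, (f x - m) ^ 2 ∂μ = ∫ x, f x ^ 2 ∂μ - m ^ 2 := by
    have e : ∀ x, (f x - m) ^ 2 = f x ^ 2 - (2 * m) * f x + m ^ 2 := fun x => by ring
    simp_rw [e]
    have i1 : Integrable (fun x => f x ^ 2) μ := cint μ (by fun_prop)
    have i2 : Integrable (fun x => (2 * m) * f x) μ := cint μ (by fun_prop)
    have i3 : Integrable (fun x => f x ^ 2 - (2 * m) * f x) μ := cint μ (by fun_prop)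
    rw [integral_add i3 (integrable_const _), integral_sub i1 i2, integral_const_mul, ← hm]
    simp; ring
  linarith

lemma aff_int {μ : Measure (Sph d)} [IsProbabilityMeasure μ] {f : Sph d → ℝ}
    (hf : Integrable f μ) (c k L : ℝ) :
    ∫ x, (c - k * (L - f x)) ∂μ = c - k * (L - ∫ x, f x ∂μ) := by
  have e : ∀ x, c - k * (L - f x) = (c - k * L) + k * f x := fun x => by ring
  simp_rw [e]
  rw [integral_add (integrable_const _) (hf.const_mul k), integral_const_mul]
  simp; ring

/-- rough concentration -/
lemma rough {lam : Fin d → ℝ} {i0 : Fin d} (hpos : ∀ i, 0 < lam i) {l2 : ℝ} (hl20 : 0 < l2) (hl2 : l2 < lam i0)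
    (hle2 : ∀ i ≠ i0, lam i ≤ l2) {ω : Measure (Sph d)} (hω : IsUniform ω) {δ : ℝ} (hδ : 0 < δ) :
    ∃ ε₀ > 0, ∀ ε, 0 < ε → ε < ε₀ → ∀ μ : Measure (Sph d), IsMinimizer lam ω ε μ →
      ∃ s : ℝ, (s = 1 ∨ s = -1) ∧ ∫ x, rr s i0 x ^ 2 ∂μ ≤ δ := by
  have := hω.1
  have hle : ∀ i, lam i ≤ lam i0 := fun i => by
    by_cases hi : i = i0
    · rw [hi]
    · exact (hle2 i hi).trans hl2.le
  set L := lam i0 with hL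
  set τ := δ * (L - l2) * exp (-L) / 4 with hτ
  have hτ0 : 0 < τ := by
    have : 0 < L - l2 := by linarith
    positivity
  -- pole
  let e : Sph d := ⟨EuclideanSpace.single i0 1, by simp⟩
  have hKe : Kker lam e e = exp L := by
    unfold Kker qA
    congr 1
    rw [Finset.sum_eq_single i0]
    · simp [e, hL]
    · intro b _ hb
      simp [e, hb]
    · simp
  obtain ⟨U, hU, heU, hUK⟩ : ∃ U : Set (Sph d), IsOpen U ∧ e ∈ U ∧
      ∀ x ∈ U, ∀ y ∈ U, exp L - τ ≤ Kker lam x y := by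
    have hopen : IsOpen {z : Sph d × Sph d | exp L - τ < Kker lam z.1 z.2} :=
      isOpen_lt continuous_const (K_cont lam)
    obtain ⟨u, v, hu, hv, h1, h2, h3⟩ := isOpen_prod_iff.1 hopen e e (by
      simp only [Set.mem_ofPred_eq, hKe]; linarith)
    exact ⟨u ∩ v, hu.inter hv, ⟨h1, h2⟩, fun x hx y hy =>
      (h3 (Set.mk_mem_prod hx.1 hy.2) : exp L - τ < Kker lam x y).le⟩
  have hUpos := unif_open_pos hω hU ⟨e, heU⟩
  set b := |log (ω.real U)| with hb
  refine ⟨τ / (2 * (b + 1)), by positivity, fun ε hε hε0 μ hμ => ?_⟩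
  have := hμ.1
  have hcap := cap_compare hU hUpos hUK hε hμ
  have h1 : exp L - 2 * τ ≤ IA lam μ := by
    rw [lt_div_iff₀ (by positivity)] at hε0
    have : -b ≤ log (ω.real U) := neg_abs_le _
    nlinarith
  -- chord bound
  have h2 : IA lam μ ≤ exp L - exp (-L) * (L - ∑ i, lam i *
      (∫ x : Sph d, (x : EuclideanSpace ℝ (Fin d)) i ∂μ) ^ 2) := by
    rw [← double_qA]
    have hpt : ∀ x y : Sph d, Kker lam x y ≤ exp L - exp (-L) * (L -
        qA lam (x : EuclideanSpace ℝ (Fin d)) (y : EuclideanSpace ℝ (Fin d))) := by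
      intro x y
      have hq := abs_le.1 (qA_abs hpos hle x y)
      unfold Kker
      set t := qA lam (x : EuclideanSpace ℝ (Fin d)) (y : EuclideanSpace ℝ (Fin d))
      have e1 : exp L = exp t * exp (L - t) := by rw [← exp_add]; ring_nf
      have e2 := add_one_le_exp (L - t)
      have e3 : exp (-L) ≤ exp t := exp_le_exp.2 hq.1
      have e4 : 0 ≤ L - t := by linarith [hq.2]
      nlinarith [mul_le_mul_of_nonneg_left e2 (exp_pos t).le, mul_le_mul_of_nonneg_right e3 e4]
    have hqc := qA_cont lam
    have hqx : ∀ x : Sph d, Continuous fun y : Sph d =>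
        qA lam (x : EuclideanSpace ℝ (Fin d)) (y : EuclideanSpace ℝ (Fin d)) := fun x =>
      hqc.comp (by fun_prop : Continuous fun y : Sph d => (x, y))
    have hin : ∀ x : Sph d, WA lam μ x ≤ exp L - exp (-L) * (L - ∫ y : Sph d,
        qA lam (x : EuclideanSpace ℝ (Fin d)) (y : EuclideanSpace ℝ (Fin d)) ∂μ) := by
      intro x
      have i1 := cint μ (hqx x)
      calc WA lam μ x ≤ ∫ y : Sph d, (exp L - exp (-L) * (L -
          qA lam (x : EuclideanSpace ℝ (Fin d)) (y : EuclideanSpace ℝ (Fin d)))) ∂μ :=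
            integral_mono (cint _ (K_cont_right lam x))
              ((integrable_const _).sub (((integrable_const _).sub i1).const_mul _)) (hpt x)
        _ = _ := by exact aff_int i1 _ _ _
    have i2 : Integrable (fun x : Sph d => ∫ y : Sph d,
        qA lam (x : EuclideanSpace ℝ (Fin d)) (y : EuclideanSpace ℝ (Fin d)) ∂μ) μ :=
      cint μ (param_cont μ (F := fun x y : Sph d =>
        qA lam (x : EuclideanSpace ℝ (Fin d)) (y : EuclideanSpace ℝ (Fin d))) hqc)
    calc IA lam μ = ∫ x, WA lam μ x ∂μ := rfl
      _ ≤ ∫ x : Sph d, (exp L - exp (-L) * (L - ∫ y : Sph d,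
        qA lam (x : EuclideanSpace ℝ (Fin d)) (y : EuclideanSpace ℝ (Fin d)) ∂μ)) ∂μ :=
          integral_mono (cint _ (W_cont lam μ))
              ((integrable_const _).sub (((integrable_const _).sub i2).const_mul _)) hin
      _ = _ := by exact aff_int i2 _ _ _
  set m : Fin d → ℝ := fun i => ∫ x : Sph d, (x : EuclideanSpace ℝ (Fin d)) i ∂μ with hm
  have hmsum : ∑ i, m i ^ 2 ≤ 1 := by
    calc ∑ i, m i ^ 2 ≤ ∑ i, ∫ x : Sph d, (x : EuclideanSpace ℝ (Fin d)) i ^ 2 ∂μ :=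
          Finset.sum_le_sum fun i _ => mean_sq_le μ (coord_cont i)
      _ = ∫ x : Sph d, ∑ i, (x : EuclideanSpace ℝ (Fin d)) i ^ 2 ∂μ :=
          (integral_finsetSum _ fun i _ => cint μ ((coord_cont i).pow 2)).symm
      _ = 1 := by simp_rw [sum_sq]; simp
  have hquad : ∑ i, lam i * m i ^ 2 ≤ L * m i0 ^ 2 + l2 * (1 - m i0 ^ 2) := by
    rw [← Finset.add_sum_erase _ _ (Finset.mem_univ i0)] at hmsum ⊢
    have : ∑ i ∈ Finset.univ.erase i0, lam i * m i ^ 2 ≤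
        l2 * ∑ i ∈ Finset.univ.erase i0, m i ^ 2 := by
      rw [Finset.mul_sum]
      refine Finset.sum_le_sum fun i hi => ?_
      exact mul_le_mul_of_nonneg_right (hle2 i (Finset.ne_of_mem_erase hi)) (sq_nonneg _)
    have hS : 0 ≤ ∑ i ∈ Finset.univ.erase i0, m i ^ 2 := Finset.sum_nonneg fun i _ => sq_nonneg _
    have := mul_le_mul_of_nonneg_left
      (show ∑ i ∈ Finset.univ.erase i0, m i ^ 2 ≤ 1 - m i0 ^ 2 by linarith) hl20.le
    linarith
  have hexp : exp (-L) * exp L = 1 := by rw [← exp_add]; simp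
  have hfin : (1 - m i0 ^ 2) ≤ δ / 2 := by
    have e1 : exp (-L) * ((L - l2) * (1 - m i0 ^ 2)) ≤ exp (-L) * ((L - l2) * (δ / 2)) := by
      have := mul_le_mul_of_nonneg_left hquad (exp_pos (-L)).le
      nlinarith [h1, h2]
    have e2 := le_of_mul_le_mul_left e1 (exp_pos _)
    exact le_of_mul_le_mul_left e2 (by linarith)
  have hm1 : m i0 ^ 2 ≤ 1 :=
    (Finset.single_le_sum (f := fun i => m i ^ 2) (fun i _ => sq_nonneg _)
      (Finset.mem_univ i0)).trans hmsum
  have hmain : ∀ s : ℝ, s ^ 2 = 1 → 0 ≤ s * m i0 → ∫ x, rr s i0 x ^ 2 ∂μ ≤ δ := by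
    intro s hs hsm
    have e1 : ∫ x, rr s i0 x ^ 2 ∂μ = 2 * (1 - s * m i0) := by
      simp_rw [rr_sq hs]
      rw [integral_const_mul, integral_sub (integrable_const _) (cint μ (aa_cont s i0))]
      unfold aa
      rw [integral_const_mul]; simp [hm]
    have e2 : (s * m i0) ^ 2 = m i0 ^ 2 := by rw [mul_pow, hs, one_mul]
    have e3 : s * m i0 ≤ 1 := by nlinarith
    rw [e1]; nlinarith
  rcases le_total 0 (m i0) with h | h
  · exact ⟨1, Or.inl rfl, hmain 1 (by norm_num) (by linarith)⟩
  · exact ⟨-1, Or.inr rfl, hmain (-1) (by norm_num) (by linarith)⟩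

lemma tilted_far {ω : Measure (Sph d)} [IsProbabilityMeasure ω] {f : Sph d → ℝ}
    (hf : Continuous f) {F N : Set (Sph d)} (hF : MeasurableSet F) (hN : MeasurableSet N)
    {M c : ℝ} (hM : ∀ x ∈ F, f x ≤ M) (hNc : ∀ x ∈ N, M + c ≤ f x) (hpos : 0 < ω.real N) :
    (ω.tilted f).real F ≤ exp (-c) / ω.real N := by
  have hi : Integrable (fun x => exp (f x)) ω := cint _ (Real.continuous_exp.comp hf)
  have hZ : exp (M + c) * ω.real N ≤ ∫ x, exp (f x) ∂ω := by
    calc exp (M + c) * ω.real N = ∫ x in N, exp (M + c) ∂ω := by simp [mul_comm]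
      _ ≤ ∫ x in N, exp (f x) ∂ω := setIntegral_mono_on (integrable_const _).integrableOn
          hi.integrableOn hN (fun x hx => exp_le_exp.2 (hNc x hx))
      _ ≤ _ := setIntegral_le_integral hi (Eventually.of_forall fun x => (exp_pos _).le)
  have hF1 : ∫ x in F, exp (f x) ∂ω ≤ exp M := by
    calc ∫ x in F, exp (f x) ∂ω ≤ ∫ x in F, exp M ∂ω := setIntegral_mono_on hi.integrableOn
          (integrable_const _).integrableOn hF (fun x hx => exp_le_exp.2 (hM x hx))
      _ = ω.real F * exp M := by simp
      _ ≤ 1 * exp M := mul_le_mul_of_nonneg_right measureReal_le_one (exp_pos _).le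
      _ = _ := one_mul _
  have h0 : 0 ≤ ∫ x in F, exp (f x) ∂ω := integral_nonneg fun x => (exp_pos _).le
  rw [Measure.real, tilted_apply_eq_ofReal_integral' f hF, integral_div,
    ENNReal.toReal_ofReal (div_nonneg h0 (by positivity))]
  have hZpos : 0 < exp (M + c) * ω.real N := by positivity
  calc _ ≤ exp M / (exp (M + c) * ω.real N) := div_le_div₀ (exp_pos _).le hF1 hZpos hZ
    _ = exp (-c) / ω.real N := by
      rw [exp_add, exp_neg]; field_simp

lemma W_near {lam : Fin d → ℝ} {i0 : Fin d} (hpos : ∀ i, 0 < lam i) (hle : ∀ i, lam i ≤ lam i0)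
    {s : ℝ} (hs : s ^ 2 = 1) (μ : Measure (Sph d)) [IsProbabilityMeasure μ] (x : Sph d) :
    |WA lam μ x - exp (lam i0 * aa s i0 x)| ≤
      exp (lam i0) * (3 * lam i0 * ∫ y, rr s i0 y ∂μ) := by
  have e : WA lam μ x - exp (lam i0 * aa s i0 x) =
      ∫ y, (Kker lam x y - exp (lam i0 * aa s i0 x)) ∂μ := by
    rw [integral_sub (cint _ (K_cont_right lam x)) (integrable_const _)]
    simp [WA]
  rw [e, ← integral_const_mul, ← integral_const_mul]
  refine (abs_integral_le_integral_abs).trans ?_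
  have hr := rr_cont s i0
  have hk := K_cont_right lam x
  exact integral_mono (cint μ (by fun_prop)) (cint μ (by fun_prop)) (K_near hpos hle hs x)

lemma exp_neg_div_le {c ε : ℝ} (hc : 0 < c) (hε : 0 < ε) : exp (-(c / ε)) ≤ 2 * ε ^ 2 / c ^ 2 := by
  have h := Real.quadratic_le_exp_of_nonneg (show 0 ≤ c / ε by positivity)
  rw [exp_neg]
  have h1 : (c / ε) ^ 2 / 2 ≤ exp (c / ε) := by
    have : 0 < c / ε := by positivity
    linarith
  calc (exp (c / ε))⁻¹ ≤ ((c / ε) ^ 2 / 2)⁻¹ := inv_anti₀ (by positivity) h1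
    _ = _ := by field_simp

theorem third_moment {lam : Fin d → ℝ} {i0 : Fin d} (hpos : ∀ i, 0 < lam i) {l2 : ℝ}
    (hl20 : 0 < l2) (hl2 : l2 < lam i0)
    (hle2 : ∀ i ≠ i0, lam i ≤ l2) {ω : Measure (Sph d)} (hω : IsUniform ω) {η : ℝ} (hη : 0 < η) :
    ∃ ε₀ > 0, ∀ ε, 0 < ε → ε < ε₀ → ∀ μ : Measure (Sph d), IsMinimizer lam ω ε μ →
      ∃ s : ℝ, s ^ 2 = 1 ∧ ∫ x, rr s i0 x ^ 3 ∂μ ≤ η * ∫ x, rr s i0 x ^ 2 ∂μ + η * ε := by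
  have := hω.1
  have hle : ∀ i, lam i ≤ lam i0 := fun i => by
    by_cases hi : i = i0
    · rw [hi]
    · exact (hle2 i hi).trans hl2.le
  set L := lam i0 with hL
  have hL0 : 0 < L := hpos i0
  set G := exp (L * (1 - η ^ 2 / 8)) - exp (L * (1 - η ^ 2 / 2)) with hG
  have hG0 : 0 < G := by
    rw [hG, sub_pos, exp_lt_exp]
    have : 0 < η ^ 2 := by positivity
    nlinarith
  set δ := (G / (12 * exp L * L)) ^ 2 with hδ
  have hδ0 : 0 < δ := by positivity
  obtain ⟨ε₁, hε₁, hrough⟩ := rough hpos hl20 hl2 hle2 hω hδ0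
  have hNpos : ∀ s : ℝ, (s = 1 ∨ s = -1) → 0 < ω.real {x | rr s i0 x < η / 2} := by
    intro s hs
    have hs2 : s ^ 2 = 1 := by rcases hs with h | h <;> rw [h] <;> norm_num
    refine ENNReal.toReal_pos (unif_open_pos hω ?_ ?_).ne' (measure_ne_top _ _)
    · exact isOpen_lt (rr_cont s i0) continuous_const
    · refine ⟨⟨EuclideanSpace.single i0 s, ?_⟩, ?_⟩
      · rcases hs with h | h <;> simp [h]
      · simp only [Set.mem_ofPred_eq, rr, aa]
        have : 2 * (1 - s * (EuclideanSpace.single i0 s : EuclideanSpace ℝ (Fin d)) i0) = 0 := by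
          simp; nlinarith
        rw [this]; simp [hη]
  set b := min (ω.real {x | rr 1 i0 x < η / 2}) (ω.real {x | rr (-1) i0 x < η / 2}) with hb
  have hb0 : 0 < b := lt_min (hNpos 1 (Or.inl rfl)) (hNpos (-1) (Or.inr rfl))
  refine ⟨min ε₁ (η * (G / 2) ^ 2 * b / 16), lt_min hε₁ (by positivity), ?_⟩
  intro ε hε hε0 μ hμ
  have := hμ.1
  obtain ⟨s, hs, hD⟩ := hrough ε hε (hε0.trans_le (min_le_left _ _)) μ hμ
  have hs2 : s ^ 2 = 1 := by rcases hs with h | h <;> rw [h] <;> norm_num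
  refine ⟨s, hs2, ?_⟩
  set N := {x | rr s i0 x < η / 2} with hN
  have hbN : b ≤ ω.real N := by
    rcases hs with h | h
    · rw [hN, h]; exact min_le_left _ _
    · rw [hN, h]; exact min_le_right _ _
  have hrc := rr_cont s i0
  have hr1 : ∫ x, rr s i0 x ∂μ ≤ G / (12 * exp L * L) := by
    refine abs_le_of_sq_le_sq' ?_ (by positivity) |>.2
    exact (mean_sq_le μ hrc).trans hD
  have hW : ∀ x, |WA lam μ x - exp (L * aa s i0 x)| ≤ G / 4 := by
    intro x
    refine (W_near hpos hle hs2 μ x).trans ?_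
    calc _ ≤ exp L * (3 * L * (G / (12 * exp L * L))) := by gcongr
      _ = G / 4 := by field_simp; norm_num
  set F := {x | η < rr s i0 x} with hF
  have hFm : MeasurableSet F := (isOpen_lt continuous_const hrc).measurableSet
  have hNm : MeasurableSet N := (isOpen_lt hrc continuous_const).measurableSet
  have hfar := tilted_far (ω := ω) (f := fun x => WA lam μ x / ε) (F := F) (N := N)
    (M := (exp (L * (1 - η ^ 2 / 2)) + G / 4) / ε) (c := G / 2 / ε)
    ((W_cont lam μ).div_const ε) hFm hNm ?_ ?_ (hb0.trans_le hbN)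
  rotate_left
  · intro x hx
    refine div_le_div_of_nonneg_right ?_ hε.le
    have h1 := (abs_le.1 (hW x)).2
    have h2 : exp (L * aa s i0 x) ≤ exp (L * (1 - η ^ 2 / 2)) := by
      rw [exp_le_exp]
      refine mul_le_mul_of_nonneg_left ?_ hL0.le
      rw [aa_eq hs2]
      have : η < rr s i0 x := hx
      nlinarith
    linarith
  · intro x hx
    rw [← add_div]
    refine div_le_div_of_nonneg_right ?_ hε.le
    have h1 := (abs_le.1 (hW x)).1
    have h2 : exp (L * (1 - η ^ 2 / 8)) ≤ exp (L * aa s i0 x) := by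
      rw [exp_le_exp]
      refine mul_le_mul_of_nonneg_left ?_ hL0.le
      rw [aa_eq hs2]
      have h3 : rr s i0 x < η / 2 := hx
      have := rr_nonneg s i0 x
      nlinarith
    linarith
  rw [← min_gibbs hε hμ] at hfar
  have hμF : μ.real F ≤ η / 8 * ε := by
    have h1 := exp_neg_div_le (show 0 < G / 2 by positivity) hε
    have h2 : ε < η * (G / 2) ^ 2 * b / 16 := hε0.trans_le (min_le_right _ _)
    calc μ.real F ≤ exp (-(G / 2 / ε)) / ω.real N := hfar
      _ ≤ (2 * ε ^ 2 / (G / 2) ^ 2) / b := div_le_div₀ (by positivity) h1 hb0 hbN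
      _ ≤ η / 8 * ε := by
        rw [div_div, div_le_iff₀ (by positivity)]
        nlinarith
  have hpt : ∀ x, rr s i0 x ^ 3 ≤ η * rr s i0 x ^ 2 + F.indicator (fun _ => (8 : ℝ)) x := by
    intro x
    have h0 := rr_nonneg s i0 x
    have h2 := rr_le_two hs2 i0 x
    by_cases hx : x ∈ F
    · rw [Set.indicator_of_mem hx]
      have : rr s i0 x ^ 3 ≤ 2 ^ 3 := by gcongr
      have : 0 ≤ η * rr s i0 x ^ 2 := by positivity
      linarith
    · rw [Set.indicator_of_notMem hx]
      have : rr s i0 x ≤ η := not_lt.1 hx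
      nlinarith [mul_le_mul_of_nonneg_right this (sq_nonneg (rr s i0 x))]
  have i1 : Integrable (fun x => η * rr s i0 x ^ 2) μ := cint μ (by fun_prop)
  have i2 : Integrable (F.indicator (fun _ => (8 : ℝ))) μ := (integrable_const _).indicator hFm
  calc ∫ x, rr s i0 x ^ 3 ∂μ ≤ ∫ x, (η * rr s i0 x ^ 2 + F.indicator (fun _ => (8 : ℝ)) x) ∂μ :=
        integral_mono (cint μ (by fun_prop)) (i1.add i2) hpt
    _ = η * ∫ x, rr s i0 x ^ 2 ∂μ + μ.real F * 8 := by
        rw [integral_add i1 i2, integral_const_mul, integral_indicator hFm]; simp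
    _ ≤ _ := by linarith

/-- rotation in the plane `(i0,i)` as a linear map -/
def rotL (i0 i : Fin d) (t : ℝ) : EuclideanSpace ℝ (Fin d) →ₗ[ℝ] EuclideanSpace ℝ (Fin d) where
  toFun x := WithLp.toLp 2 (fun k => if k = i0 then cos t * x i0 - sin t * x i
    else if k = i then sin t * x i0 + cos t * x i else x k)
  map_add' x y := by
    ext k
    simp only [PiLp.add_apply]
    split_ifs <;> ring
  map_smul' c x := by
    ext k
    simp only [PiLp.smul_apply, smul_eq_mul, RingHom.id_apply]
    split_ifs <;> ring

lemma rotL_apply (i0 i : Fin d) (t : ℝ) (x : EuclideanSpace ℝ (Fin d)) (k : Fin d) :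
    rotL i0 i t x k = if k = i0 then cos t * x i0 - sin t * x i
    else if k = i then sin t * x i0 + cos t * x i else x k := rfl

lemma sum_two {i0 i : Fin d} (hi : i ≠ i0) (f : Fin d → ℝ) :
    ∑ k, f k = f i0 + f i + ∑ k ∈ (Finset.univ.erase i0).erase i, f k := by
  rw [← Finset.add_sum_erase _ _ (Finset.mem_univ i0),
    ← Finset.add_sum_erase _ _ (show i ∈ Finset.univ.erase i0 by simp [hi])]
  ring

/-- rotation as a linear isometry equivalence -/
def rot {i0 i : Fin d} (hi : i ≠ i0) (t : ℝ) :
    EuclideanSpace ℝ (Fin d) ≃ₗᵢ[ℝ] EuclideanSpace ℝ (Fin d) :=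
  LinearIsometry.toLinearIsometryEquiv ⟨rotL i0 i t, by
    intro x
    rw [← sq_eq_sq₀ (norm_nonneg _) (norm_nonneg _), EuclideanSpace.real_norm_sq_eq,
      EuclideanSpace.real_norm_sq_eq, sum_two hi, sum_two hi]
    have : ∑ k ∈ (Finset.univ.erase i0).erase i, (rotL i0 i t x k) ^ 2 =
        ∑ k ∈ (Finset.univ.erase i0).erase i, (x k) ^ 2 := by
      refine Finset.sum_congr rfl fun k hk => ?_
      simp only [Finset.mem_erase, Finset.mem_univ, and_true] at hk
      rw [rotL_apply, if_neg hk.2, if_neg hk.1]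
    rw [this, rotL_apply, rotL_apply, if_pos rfl, if_neg hi, if_pos rfl]
    linear_combination (x i0 ^ 2 + x i ^ 2) * (sin_sq_add_cos_sq t)⟩ rfl

/-- flow on the sphere -/
def flow {i0 i : Fin d} (hi : i ≠ i0) (t : ℝ) (x : Sph d) : Sph d := sphMap (rot hi t) x

lemma flow_coord {i0 i : Fin d} (hi : i ≠ i0) (t : ℝ) (x : Sph d) (k : Fin d) :
    ((flow hi t x : Sph d) : EuclideanSpace ℝ (Fin d)) k =
    if k = i0 then cos t * (x : EuclideanSpace ℝ (Fin d)) i0 - sin t * (x : EuclideanSpace ℝ (Fin d)) i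
    else if k = i then sin t * (x : EuclideanSpace ℝ (Fin d)) i0 +
      cos t * (x : EuclideanSpace ℝ (Fin d)) i else (x : EuclideanSpace ℝ (Fin d)) k := rfl

/-- derivative of the coordinates along the flow -/
def Dc (i0 i k : Fin d) (x : Sph d) : ℝ :=
  if k = i0 then - (x : EuclideanSpace ℝ (Fin d)) i
    else if k = i then (x : EuclideanSpace ℝ (Fin d)) i0 else 0

lemma Dc_cont (i0 i k : Fin d) : Continuous (Dc i0 i k) := by
  unfold Dc
  split_ifs <;> fun_prop

lemma flow_deriv {i0 i : Fin d} (hi : i ≠ i0) (t : ℝ) (x : Sph d) (k : Fin d) :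
    HasDerivAt (fun t => ((flow hi t x : Sph d) : EuclideanSpace ℝ (Fin d)) k)
      (Dc i0 i k (flow hi t x)) t := by
  simp only [flow_coord, Dc]
  by_cases h0 : k = i0
  · simp only [if_pos h0, if_neg hi, if_true]
    convert! ((hasDerivAt_cos t).mul_const _).sub ((hasDerivAt_sin t).mul_const _) using 1
    ring
  · by_cases h1 : k = i
    · simp only [if_neg h0, if_pos h1, if_true]
      convert! ((hasDerivAt_sin t).mul_const _).add ((hasDerivAt_cos t).mul_const _) using 1
      ring
    · simp only [if_neg h0, if_neg h1]
      exact hasDerivAt_const _ _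

lemma flow_cont {i0 i : Fin d} (hi : i ≠ i0) (t : ℝ) : Continuous (flow hi t) := by
  unfold flow sphMap
  exact Continuous.subtype_mk ((rot hi t).continuous.comp continuous_subtype_val) _

lemma stein_base {ω : Measure (Sph d)} (hω : IsUniform ω) {i0 i : Fin d} (hi : i ≠ i0)
    {F F' : Sph d → ℝ} (hF : Continuous F) (hF' : Continuous F')
    (hd : ∀ x t, HasDerivAt (fun t => F (flow hi t x)) (F' (flow hi t x)) t) :
    ∫ x, F' x ∂ω = 0 := by
  have := hω.1
  have hinv : ∀ (H : Sph d → ℝ), Continuous H → ∀ t, ∫ x, H (flow hi t x) ∂ω = ∫ x, H x ∂ω := by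
    intro H hH t
    conv_rhs => rw [← hω.2 (rot hi t)]
    rw [integral_map]
    · rfl
    · exact (flow_cont hi t).measurable.aemeasurable
    · exact hH.aestronglyMeasurable
  obtain ⟨C, hC⟩ := (isCompact_univ.image hF').isBounded.exists_norm_le
  have h := (hasDerivAt_integral_of_dominated_loc_of_deriv_le (μ := ω)
    (F := fun t x => F (flow hi t x)) (F' := fun t x => F' (flow hi t x)) (x₀ := (0 : ℝ))
    (bound := fun _ => C) (s := Set.univ) univ_mem
    (Eventually.of_forall fun t => (hF.comp (flow_cont hi t)).aestronglyMeasurable)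
    (cint _ (hF.comp (flow_cont hi 0))) (hF'.comp (flow_cont hi 0)).aestronglyMeasurable
    (Eventually.of_forall fun x t _ => hC _ ⟨_, trivial, rfl⟩) (integrable_const _)
    (Eventually.of_forall fun x t _ => hd x t)).2
  rw [hinv F' hF' 0] at h
  simp only [hinv F hF] at h
  exact h.unique (hasDerivAt_const _ _)

/-- derivative of `qA` along the flow -/
def Rq (lam : Fin d → ℝ) (i0 i : Fin d) (x y : Sph d) : ℝ :=
  lam i * (x : EuclideanSpace ℝ (Fin d)) i0 * (y : EuclideanSpace ℝ (Fin d)) i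
   - lam i0 * (x : EuclideanSpace ℝ (Fin d)) i * (y : EuclideanSpace ℝ (Fin d)) i0

lemma Rq_cont (lam : Fin d → ℝ) (i0 i : Fin d) :
    Continuous (fun z : Sph d × Sph d => Rq lam i0 i z.1 z.2) := by
  unfold Rq; fun_prop

lemma K_deriv (lam : Fin d → ℝ) {i0 i : Fin d} (hi : i ≠ i0) (x y : Sph d) (t : ℝ) :
    HasDerivAt (fun t => Kker lam (flow hi t x) y)
      (Rq lam i0 i (flow hi t x) y * Kker lam (flow hi t x) y) t := by
  unfold Kker
  have h1 : HasDerivAt (fun t => qA lam ((flow hi t x : Sph d) : EuclideanSpace ℝ (Fin d))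
      (y : EuclideanSpace ℝ (Fin d))) (Rq lam i0 i (flow hi t x) y) t := by
    unfold qA
    have h2 := HasDerivAt.fun_sum (u := Finset.univ) (fun k _ =>
      ((flow_deriv hi t x k).const_mul (lam k)).mul_const ((y : EuclideanSpace ℝ (Fin d)) k))
    convert! h2 using 1
    rw [sum_two hi, Finset.sum_eq_zero]
    · simp [Dc, hi, Rq]; ring
    · intro k hk
      simp only [Finset.mem_erase, Finset.mem_univ, and_true] at hk
      simp [Dc, hk.1, hk.2]
  convert! h1.exp using 1
  ring

/-- derivative of `W` along the flow -/
def RW (lam : Fin d → ℝ) (i0 i : Fin d) (μ : Measure (Sph d)) (x : Sph d) : ℝ :=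
  ∫ y, Rq lam i0 i x y * Kker lam x y ∂μ

lemma RW_cont (lam : Fin d → ℝ) (i0 i : Fin d) (μ : Measure (Sph d)) [IsFiniteMeasure μ] :
    Continuous (RW lam i0 i μ) :=
  param_cont μ ((Rq_cont lam i0 i).mul (K_cont lam))

lemma W_deriv (lam : Fin d → ℝ) {i0 i : Fin d} (hi : i ≠ i0) (μ : Measure (Sph d))
    [IsProbabilityMeasure μ] (x : Sph d) (t : ℝ) :
    HasDerivAt (fun t => WA lam μ (flow hi t x)) (RW lam i0 i μ (flow hi t x)) t := by
  have hcont := (Rq_cont lam i0 i).mul (K_cont lam)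
  obtain ⟨C, hC⟩ := (isCompact_univ.image hcont).isBounded.exists_norm_le
  exact (hasDerivAt_integral_of_dominated_loc_of_deriv_le (μ := μ)
    (F := fun t y => Kker lam (flow hi t x) y)
    (F' := fun t y => Rq lam i0 i (flow hi t x) y * Kker lam (flow hi t x) y) (x₀ := t)
    (bound := fun _ => C) (s := Set.univ) univ_mem
    (Eventually.of_forall fun t => (K_cont_right lam _).aestronglyMeasurable)
    (cint _ (K_cont_right lam _))
    (hcont.comp (by fun_prop : Continuous fun y : Sph d => (flow hi t x, y))).aestronglyMeasurable
    (Eventually.of_forall fun y t _ => hC _ ⟨(flow hi t x, y), trivial, rfl⟩) (integrable_const _)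
    (Eventually.of_forall fun y t _ => K_deriv lam hi x y t)).2

theorem stein {lam : Fin d → ℝ} {ω : Measure (Sph d)} (hω : IsUniform ω) {ε : ℝ}
    (hε : 0 < ε) {μ : Measure (Sph d)} (hμ : IsMinimizer lam ω ε μ) {i0 i : Fin d} (hi : i ≠ i0)
    {f f' : Sph d → ℝ} (hf : Continuous f) (hf' : Continuous f')
    (hd : ∀ x t, HasDerivAt (fun t => f (flow hi t x)) (f' (flow hi t x)) t) :
    ε * ∫ x, f' x ∂μ + ∫ x, f x * RW lam i0 i μ x ∂μ = 0 := by
  have := hω.1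
  have := hμ.1
  have hWc := W_cont lam μ
  have hRc := RW_cont lam i0 i μ
  have h := stein_base hω hi (F := fun x => f x * exp (WA lam μ x / ε))
    (F' := fun x => (f' x + f x * RW lam i0 i μ x / ε) * exp (WA lam μ x / ε))
    (by fun_prop) (by fun_prop) (by
      intro x t
      convert! (hd x t).mul (((W_deriv lam hi μ x t).div_const ε).exp) using 1
      ring)
  have h2 : ∫ x, (f' x + f x * RW lam i0 i μ x / ε) ∂μ = 0 := by
    have hg := min_gibbs hε hμ
    have key : ∀ g : Sph d → ℝ, ∫ x, g x ∂μ =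
        ∫ x, g x ∂(ω.tilted (fun x => WA lam μ x / ε)) :=
      fun g => congrArg (fun m => ∫ x, g x ∂m) hg
    rw [key, integral_tilted]
    have e : ∀ x, (exp (WA lam μ x / ε) / ∫ x, exp (WA lam μ x / ε) ∂ω) •
        (f' x + f x * RW lam i0 i μ x / ε) =
        ((f' x + f x * RW lam i0 i μ x / ε) * exp (WA lam μ x / ε)) *
          (∫ x, exp (WA lam μ x / ε) ∂ω)⁻¹ := fun x => by
      rw [smul_eq_mul]; ring
    simp_rw [e]
    rw [integral_mul_const, h, zero_mul]
  have i1 : Integrable (fun x => f x * RW lam i0 i μ x / ε) μ := cint μ (by fun_prop)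
  rw [integral_add (cint μ hf') i1, integral_div] at h2
  field_simp at h2
  linarith

/-- Stein identity with `f = 1`. -/
lemma stein0 {lam : Fin d → ℝ} {ω : Measure (Sph d)} (hω : IsUniform ω) {ε : ℝ}
    (hε : 0 < ε) {μ : Measure (Sph d)} (hμ : IsMinimizer lam ω ε μ) {i0 i : Fin d} (hi : i ≠ i0) :
    ∫ z : Sph d × Sph d, Rq lam i0 i z.1 z.2 * Kker lam z.1 z.2 ∂(μ.prod μ) = 0 := by
  have := hμ.1
  have h := stein hω hε hμ hi (f := fun _ => 1) (f' := fun _ => 0) continuous_const continuous_const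
    (fun x t => hasDerivAt_const _ _)
  simp only [integral_zero, mul_zero, zero_add, one_mul] at h
  have hc : Continuous (fun z : Sph d × Sph d => Rq lam i0 i z.1 z.2 * Kker lam z.1 z.2) :=
    (Rq_cont lam i0 i).mul (K_cont lam)
  rw [integral_prod _ (cint _ hc)]
  exact h

/-- Stein identity with `f = x_j`. -/
lemma stein1 {lam : Fin d → ℝ} {ω : Measure (Sph d)} (hω : IsUniform ω) {ε : ℝ}
    (hε : 0 < ε) {μ : Measure (Sph d)} (hμ : IsMinimizer lam ω ε μ) {i0 i j : Fin d} (hi : i ≠ i0)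
    (hj : j ≠ i0) :
    ε * ((if j = i then 1 else 0) * ∫ x : Sph d, (x : EuclideanSpace ℝ (Fin d)) i0 ∂μ) +
    ∫ z : Sph d × Sph d, (z.1 : EuclideanSpace ℝ (Fin d)) j *
      (Rq lam i0 i z.1 z.2 * Kker lam z.1 z.2) ∂(μ.prod μ) = 0 := by
  have := hμ.1
  have h := stein hω hε hμ hi (f := fun x => (x : EuclideanSpace ℝ (Fin d)) j) (f' := Dc i0 i j)
    (coord_cont j) (Dc_cont i0 i j) (fun x t => flow_deriv hi t x j)
  have hc : Continuous (fun z : Sph d × Sph d => (z.1 : EuclideanSpace ℝ (Fin d)) j *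
      (Rq lam i0 i z.1 z.2 * Kker lam z.1 z.2)) :=
    ((coord_cont j).comp continuous_fst).mul ((Rq_cont lam i0 i).mul (K_cont lam))
  rw [integral_prod _ (cint _ hc)]
  simp only [integral_const_mul]
  have e : ∫ x, Dc i0 i j x ∂μ =
      (if j = i then 1 else 0) * ∫ x : Sph d, (x : EuclideanSpace ℝ (Fin d)) i0 ∂μ := by
    rw [← integral_const_mul]
    refine integral_congr_ae (Eventually.of_forall fun x => ?_)
    simp [Dc, hj]
  rw [← e]
  exact h

lemma K_kap {lam : Fin d → ℝ} {i0 : Fin d} (hpos : ∀ i, 0 < lam i) (hle : ∀ i, lam i ≤ lam i0)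
    {s : ℝ} (hs : s ^ 2 = 1) (x y : Sph d) :
    |Kker lam x y - exp (lam i0)| ≤
      exp (lam i0) * (lam i0 * (rr s i0 x ^ 2 + rr s i0 y ^ 2)) := by
  have hL := hpos i0
  have hq := (abs_le.1 (qA_abs hpos hle x y)).2
  refine (exp_lip hq le_rfl).trans (mul_le_mul_of_nonneg_left ?_ (exp_pos _).le)
  have hz := abs_le.1 (zz_abs hpos hle hs x y)
  rw [abs_of_nonpos (by linarith), qA_eq lam hs i0 x y]
  have h1 := rr_sq hs i0 x
  have h2 := rr_sq hs i0 y
  have ha := abs_le.1 (aa_abs hs i0 x)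
  have hb := abs_le.1 (aa_abs hs i0 y)
  have h3 : 1 - aa s i0 x * aa s i0 y ≤ (1 - aa s i0 x) + (1 - aa s i0 y) := by
    nlinarith [mul_nonneg (sub_nonneg.2 ha.2) (sub_nonneg.2 hb.2)]
  have h4 : rr s i0 x * rr s i0 y ≤ (rr s i0 x ^ 2 + rr s i0 y ^ 2) / 2 := by
    nlinarith [sq_nonneg (rr s i0 x - rr s i0 y)]
  have h5 := mul_le_mul_of_nonneg_left h3 hL.le
  have h6 := mul_le_mul_of_nonneg_left h4 hL.le
  have h7 : (1 - aa s i0 x) + (1 - aa s i0 y) = (rr s i0 x ^ 2 + rr s i0 y ^ 2) / 2 := by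
    linarith
  rw [h7] at h5
  linarith [hz.1]

lemma S0_pt {lam : Fin d → ℝ} {i0 : Fin d} (hpos : ∀ i, 0 < lam i) (hle : ∀ i, lam i ≤ lam i0)
    {s : ℝ} (hs : s ^ 2 = 1) {i : Fin d} (hi : i ≠ i0) (x y : Sph d) :
    |s * (Rq lam i0 i x y * Kker lam x y) - exp (lam i0) *
      (lam i * (y : EuclideanSpace ℝ (Fin d)) i - lam i0 * (x : EuclideanSpace ℝ (Fin d)) i)| ≤
      exp (lam i0) * (2 * lam i0 ^ 2 + lam i0) * (rr s i0 x ^ 3 + rr s i0 y ^ 3) := by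
  have hL := hpos i0
  have hli := hpos i
  have hlei := hle i
  have hK := K_kap hpos hle hs x y
  have hx := coord_le_rr hs i0 hi x
  have hy := coord_le_rr hs i0 hi y
  have ha := abs_le.1 (aa_abs hs i0 x)
  have hb := abs_le.1 (aa_abs hs i0 y)
  have ha1 := aa_abs hs i0 x
  have hb1 := aa_abs hs i0 y
  have hr := rr_nonneg s i0 x
  have hq := rr_nonneg s i0 y
  have h1 := aa_eq hs i0 x
  have h2 := aa_eq hs i0 y
  have hκ := exp_pos (lam i0)
  have eR : s * Rq lam i0 i x y = lam i * aa s i0 x * (y : EuclideanSpace ℝ (Fin d)) i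
      - lam i0 * (x : EuclideanSpace ℝ (Fin d)) i * aa s i0 y := by
    unfold Rq aa; ring
  set r := rr s i0 x
  set q := rr s i0 y
  set a := aa s i0 x
  set b := aa s i0 y
  set u := (x : EuclideanSpace ℝ (Fin d)) i
  set v := (y : EuclideanSpace ℝ (Fin d)) i
  set L := lam i0
  set l := lam i
  have e : s * (Rq lam i0 i x y * Kker lam x y) - exp L * (l * v - L * u) =
      (l * a * v - L * u * b) * (Kker lam x y - exp L)
        + exp L * (l * (a - 1) * v - L * u * (b - 1)) := by
    rw [← eR]; linear_combination exp L * eR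
  rw [e]
  have b1 : |l * a * v - L * u * b| ≤ L * (r + q) := by
    have t1 : |l * a * v| ≤ L * 1 * q := by
      rw [abs_mul, abs_mul, abs_of_pos hli]; gcongr
    have t2 : |L * u * b| ≤ L * r * 1 := by
      rw [abs_mul, abs_mul, abs_of_pos hL]; gcongr
    have := abs_sub (l * a * v) (L * u * b)
    linarith
  have b2 : |l * (a - 1) * v - L * u * (b - 1)| ≤ L * (r ^ 2 / 2 * q + r * (q ^ 2 / 2)) := by
    have ea : |a - 1| = r ^ 2 / 2 := by rw [abs_of_nonpos (by linarith)]; linarith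
    have eb : |b - 1| = q ^ 2 / 2 := by rw [abs_of_nonpos (by linarith)]; linarith
    have t1 : |l * (a - 1) * v| ≤ L * (r ^ 2 / 2) * q := by
      rw [abs_mul, abs_mul, abs_of_pos hli, ea]; gcongr
    have t2 : |L * u * (b - 1)| ≤ L * r * (q ^ 2 / 2) := by
      rw [abs_mul, abs_mul, abs_of_pos hL, eb]; gcongr
    have := abs_sub (l * (a - 1) * v) (L * u * (b - 1))
    linarith
  have t : r ^ 2 * q + r * q ^ 2 ≤ r ^ 3 + q ^ 3 := by
    nlinarith [mul_nonneg (add_nonneg hr hq) (sq_nonneg (r - q))]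
  have c1 : |(l * a * v - L * u * b) * (Kker lam x y - exp L)| ≤
      (L * (r + q)) * (exp L * (L * (r ^ 2 + q ^ 2))) := by
    rw [abs_mul]; gcongr
  have c2 : |exp L * (l * (a - 1) * v - L * u * (b - 1))| ≤
      exp L * (L * (r ^ 2 / 2 * q + r * (q ^ 2 / 2))) := by
    rw [abs_mul, abs_of_pos hκ]; gcongr
  have f1 : (L * (r + q)) * (exp L * (L * (r ^ 2 + q ^ 2))) ≤
      exp L * L ^ 2 * (2 * (r ^ 3 + q ^ 3)) := by
    have : (L * (r + q)) * (exp L * (L * (r ^ 2 + q ^ 2))) =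
      exp L * L ^ 2 * ((r ^ 3 + q ^ 3) + (r ^ 2 * q + r * q ^ 2)) := by ring
    rw [this]
    have : 0 ≤ exp L * L ^ 2 := by positivity
    exact mul_le_mul_of_nonneg_left (by linarith) this
  have f2 : exp L * (L * (r ^ 2 / 2 * q + r * (q ^ 2 / 2))) ≤ exp L * L * (r ^ 3 + q ^ 3) := by
    have : 0 ≤ exp L * L := by positivity
    rw [← mul_assoc]
    have h0 : 0 ≤ r ^ 3 + q ^ 3 := by positivity
    exact mul_le_mul_of_nonneg_left (by linarith) this
  refine (abs_add_le _ _).trans ((add_le_add (c1.trans f1) (c2.trans f2)).trans (le_of_eq ?_))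
  ring

lemma prod_close {μ : Measure (Sph d)} [IsProbabilityMeasure μ] {s : ℝ} {i0 : Fin d} {C : ℝ}
    {F G : Sph d × Sph d → ℝ} (hF : Continuous F) (hG : Continuous G)
    (h : ∀ z, |F z - G z| ≤ C * (rr s i0 z.1 ^ 3 + rr s i0 z.2 ^ 3)) :
    |∫ z, F z ∂(μ.prod μ) - ∫ z, G z ∂(μ.prod μ)| ≤ 2 * C * ∫ x, rr s i0 x ^ 3 ∂μ := by
  have hr := rr_cont s i0
  rw [← integral_sub (cint _ hF) (cint _ hG)]
  refine (abs_integral_le_integral_abs).trans ?_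
  have i1 : Integrable (fun z : Sph d × Sph d => rr s i0 z.1 ^ 3) (μ.prod μ) :=
    cint _ (by fun_prop)
  have i2 : Integrable (fun z : Sph d × Sph d => rr s i0 z.2 ^ 3) (μ.prod μ) :=
    cint _ (by fun_prop)
  refine (integral_mono (cint _ (by fun_prop)) ((i1.add i2).const_mul C) h).trans (le_of_eq ?_)
  simp only [Pi.add_apply]
  rw [integral_const_mul, integral_add i1 i2, integral_fun_fst (fun x => rr s i0 x ^ 3),
    integral_fun_snd (fun x => rr s i0 x ^ 3)]
  simp
  ring

lemma int_lin (ρ : Measure (Sph d × Sph d)) [IsProbabilityMeasure ρ] {f g : Sph d × Sph d → ℝ}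
    (hf : Continuous f) (hg : Continuous g) (a b : ℝ) :
    ∫ z, (a * f z - b * g z) ∂ρ = a * ∫ z, f z ∂ρ - b * ∫ z, g z ∂ρ := by
  rw [integral_sub ((cint _ hf).const_mul a) ((cint _ hg).const_mul b), integral_const_mul,
    integral_const_mul]

lemma M0 {lam : Fin d → ℝ} {i0 : Fin d} (hpos : ∀ i, 0 < lam i) (hle : ∀ i, lam i ≤ lam i0)
    {ω : Measure (Sph d)} (hω : IsUniform ω) {ε : ℝ}
    (hε : 0 < ε) {μ : Measure (Sph d)} (hμ : IsMinimizer lam ω ε μ)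
    {s : ℝ} (hs : s ^ 2 = 1) {i : Fin d} (hi : i ≠ i0) :
    exp (lam i0) * ((lam i0 - lam i) * |∫ x : Sph d, (x : EuclideanSpace ℝ (Fin d)) i ∂μ|) ≤
      2 * (exp (lam i0) * (2 * lam i0 ^ 2 + lam i0)) * ∫ x, rr s i0 x ^ 3 ∂μ := by
  have := hμ.1
  have hc : Continuous (fun z : Sph d × Sph d => Rq lam i0 i z.1 z.2 * Kker lam z.1 z.2) :=
    (Rq_cont lam i0 i).mul (K_cont lam)
  have k1 : Continuous (fun z : Sph d × Sph d => (z.1 : EuclideanSpace ℝ (Fin d)) i) :=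
    (coord_cont i).comp continuous_fst
  have k2 : Continuous (fun z : Sph d × Sph d => (z.2 : EuclideanSpace ℝ (Fin d)) i) :=
    (coord_cont i).comp continuous_snd
  have h := prod_close (μ := μ) (s := s) (i0 := i0) (continuous_const.mul hc)
    (continuous_const.mul ((continuous_const.mul k2).sub (continuous_const.mul k1)))
    (F := fun z => s * (Rq lam i0 i z.1 z.2 * Kker lam z.1 z.2))
    (G := fun z => exp (lam i0) * (lam i * (z.2 : EuclideanSpace ℝ (Fin d)) i - lam i0 *
      (z.1 : EuclideanSpace ℝ (Fin d)) i))
    (fun z => S0_pt hpos hle hs hi z.1 z.2)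
  rw [integral_const_mul, stein0 hω hε hμ hi, integral_const_mul, int_lin _ k2 k1,
    integral_fun_fst (fun x : Sph d => (x : EuclideanSpace ℝ (Fin d)) i),
    integral_fun_snd (fun x : Sph d => (x : EuclideanSpace ℝ (Fin d)) i)] at h
  simp only [probReal_univ, one_smul, mul_zero, zero_sub, abs_neg] at h
  refine le_trans (le_of_eq ?_) h
  rw [← sub_mul, abs_mul, abs_mul, abs_of_pos (exp_pos _),
    abs_of_nonpos (show lam i - lam i0 ≤ 0 by linarith [hle i])]
  ring

lemma M1 {lam : Fin d → ℝ} {i0 : Fin d} (hpos : ∀ i, 0 < lam i) (hle : ∀ i, lam i ≤ lam i0)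
    {ω : Measure (Sph d)} (hω : IsUniform ω) {ε : ℝ}
    (hε : 0 < ε) {μ : Measure (Sph d)} (hμ : IsMinimizer lam ω ε μ)
    {s : ℝ} (hs : s ^ 2 = 1) {i j : Fin d} (hi : i ≠ i0) (hj : j ≠ i0) :
    |ε * ((if j = i then 1 else 0) * (1 - (∫ x, rr s i0 x ^ 2 ∂μ) / 2))
      + exp (lam i0) * (lam i * ((∫ x : Sph d, (x : EuclideanSpace ℝ (Fin d)) j ∂μ) *
          (∫ x : Sph d, (x : EuclideanSpace ℝ (Fin d)) i ∂μ))
        - lam i0 * ∫ x : Sph d, (x : EuclideanSpace ℝ (Fin d)) j *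
          (x : EuclideanSpace ℝ (Fin d)) i ∂μ)| ≤
      2 * (exp (lam i0) * (2 * lam i0 ^ 2 + lam i0)) * ∫ x, rr s i0 x ^ 3 ∂μ := by
  have := hμ.1
  have hr := rr_cont s i0
  have hc : Continuous (fun z : Sph d × Sph d => (z.1 : EuclideanSpace ℝ (Fin d)) j *
      (Rq lam i0 i z.1 z.2 * Kker lam z.1 z.2)) :=
    ((coord_cont j).comp continuous_fst).mul ((Rq_cont lam i0 i).mul (K_cont lam))
  have k1 : Continuous (fun z : Sph d × Sph d => (z.1 : EuclideanSpace ℝ (Fin d)) j *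
      (z.1 : EuclideanSpace ℝ (Fin d)) i) :=
    ((coord_cont j).comp continuous_fst).mul ((coord_cont i).comp continuous_fst)
  have k2 : Continuous (fun z : Sph d × Sph d => (z.1 : EuclideanSpace ℝ (Fin d)) j *
      (z.2 : EuclideanSpace ℝ (Fin d)) i) :=
    ((coord_cont j).comp continuous_fst).mul ((coord_cont i).comp continuous_snd)
  have h := prod_close (μ := μ) (s := s) (i0 := i0)
    (C := exp (lam i0) * (2 * lam i0 ^ 2 + lam i0)) (continuous_const.mul hc)
    (continuous_const.mul ((continuous_const.mul k2).sub (continuous_const.mul k1)))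
    (F := fun z => s * ((z.1 : EuclideanSpace ℝ (Fin d)) j *
      (Rq lam i0 i z.1 z.2 * Kker lam z.1 z.2)))
    (G := fun z => exp (lam i0) * (lam i * ((z.1 : EuclideanSpace ℝ (Fin d)) j *
      (z.2 : EuclideanSpace ℝ (Fin d)) i) - lam i0 * ((z.1 : EuclideanSpace ℝ (Fin d)) j *
      (z.1 : EuclideanSpace ℝ (Fin d)) i)))
    (fun z => by
      have h1 := S0_pt hpos hle hs hi z.1 z.2
      have h2 := coord_abs j z.1
      refine le_trans (le_of_eq ?_) ((mul_le_of_le_one_left (abs_nonneg _) h2).trans h1)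
      rw [← abs_mul]; congr 1; ring)
  rw [integral_const_mul, integral_const_mul, int_lin _ k2 k1,
    integral_prod_mul (fun x : Sph d => (x : EuclideanSpace ℝ (Fin d)) j)
      (fun x : Sph d => (x : EuclideanSpace ℝ (Fin d)) i),
    integral_fun_fst (fun x : Sph d => (x : EuclideanSpace ℝ (Fin d)) j *
      (x : EuclideanSpace ℝ (Fin d)) i)] at h
  simp only [probReal_univ, one_smul] at h
  have hst := stein1 hω hε hμ hi hj
  have ha : s * ∫ x : Sph d, (x : EuclideanSpace ℝ (Fin d)) i0 ∂μ =
      1 - (∫ x, rr s i0 x ^ 2 ∂μ) / 2 := by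
    rw [← integral_const_mul]
    have : ∀ x : Sph d, s * (x : EuclideanSpace ℝ (Fin d)) i0 = 1 - rr s i0 x ^ 2 / 2 :=
      fun x => aa_eq hs i0 x
    simp_rw [this]
    rw [integral_sub (integrable_const _) (cint _ (by fun_prop)), integral_div]
    simp
  rw [← ha]
  rw [abs_sub_comm] at h
  refine le_trans (le_of_eq ?_) h
  congr 1
  linear_combination s * hst

set_option maxHeartbeats 1600000 in
/-- Moment asymptotics of minimizers. -/
theorem moments {lam : Fin d → ℝ} {i0 : Fin d} (hpos : ∀ i, 0 < lam i) {l2 : ℝ} (hl20 : 0 < l2)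
    (hl2 : l2 < lam i0)
    (hle2 : ∀ i ≠ i0, lam i ≤ l2) {ω : Measure (Sph d)} (hω : IsUniform ω) {θ : ℝ} (hθ : 0 < θ) :
    ∃ ε₀ > 0, ∀ ε, 0 < ε → ε < ε₀ → ∀ μ : Measure (Sph d), IsMinimizer lam ω ε μ →
      ∃ s : ℝ, s ^ 2 = 1 ∧ ∫ x, rr s i0 x ^ 3 ∂μ ≤ θ * ε ∧
        (∀ i ≠ i0, |∫ x : Sph d, (x : EuclideanSpace ℝ (Fin d)) i ∂μ| ≤ θ * ε) ∧
        (∀ i ≠ i0, ∀ j ≠ i0, |exp (lam i0) * lam i0 *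
          (∫ x : Sph d, (x : EuclideanSpace ℝ (Fin d)) j * (x : EuclideanSpace ℝ (Fin d)) i ∂μ)
          - ε * (if j = i then 1 else 0)| ≤ θ * ε) := by
  have hL := hpos i0
  have hκ := exp_pos (lam i0)
  have hle : ∀ i, lam i ≤ lam i0 := fun i => by
    by_cases h : i = i0
    · rw [h]
    · exact (hle2 i h).trans hl2.le
  set L := lam i0 with hLdef
  set κ := exp L with hκdef
  obtain ⟨C0, hC0⟩ : ∃ C0, C0 = 2 * (κ * (2 * L ^ 2 + L)) := ⟨_, rfl⟩
  have hC0p : 0 < C0 := by rw [hC0]; positivity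
  have hG : 0 < κ * (L - l2) := mul_pos hκ (by linarith)
  obtain ⟨C1, hC1⟩ : ∃ C1, C1 = C0 / (κ * (L - l2)) := ⟨_, rfl⟩
  have hC1p : 0 < C1 := by rw [hC1]; positivity
  obtain ⟨C2, hC2⟩ : ∃ C2, C2 = C0 + κ * (L * C1) := ⟨_, rfl⟩
  have hC2p : 0 < C2 := by rw [hC2]; positivity
  obtain ⟨C3, hC3⟩ : ∃ C3, C3 = (d + d * C2 + κ * L / 2) / (κ * L) := ⟨_, rfl⟩
  have hC3p : 0 < C3 := by rw [hC3]; positivity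
  obtain ⟨B, hB⟩ : ∃ B, B = (2 * C3 + 2) * (1 + C1 + 2 * C2) := ⟨_, rfl⟩
  have hBp : 0 < B := by rw [hB]; positivity
  obtain ⟨η, hη⟩ : ∃ η, η = min (1 / (2 * (C3 + 1))) (θ / B) := ⟨_, rfl⟩
  have hηp : 0 < η := by rw [hη]; exact lt_min (by positivity) (by positivity)
  have hη1 : η * (2 * (C3 + 1)) ≤ 1 := by
    rw [← le_div_iff₀ (by positivity), hη]; exact min_le_left _ _
  have hη2 : η * B ≤ θ := by
    rw [← le_div_iff₀ (by positivity), hη]; exact min_le_right _ _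
  obtain ⟨ε₁, hε₁, H⟩ := third_moment hpos hl20 hl2 hle2 hω hηp
  refine ⟨min ε₁ (θ / (2 * C3 + 1)), lt_min hε₁ (by positivity), fun ε hε hlt μ hμ => ?_⟩
  have hε2 : ε * (2 * C3 + 1) ≤ θ := by
    rw [← le_div_iff₀ (by positivity)]; exact (hlt.trans_le (min_le_right _ _)).le
  obtain ⟨s, hs, hT⟩ := H ε hε (hlt.trans_le (min_le_left _ _)) μ hμ
  have := hμ.1
  have hr := rr_cont s i0
  have m0 := fun i (hi : i ≠ i0) => M0 hpos hle hω hε hμ hs hi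
  have m1 := fun i (hi : i ≠ i0) j (hj : j ≠ i0) => M1 hpos hle hω hε hμ hs hi hj
  rw [← hLdef, ← hκdef, ← hC0] at m0 m1
  set T := ∫ x, rr s i0 x ^ 3 ∂μ with hTdef
  set D := ∫ x, rr s i0 x ^ 2 ∂μ with hDdef
  have hT0 : 0 ≤ T := integral_nonneg fun x => pow_nonneg (rr_nonneg s i0 x) 3
  have hD0 : 0 ≤ D := integral_nonneg fun x => sq_nonneg _
  set m : Fin d → ℝ := fun i => ∫ x : Sph d, (x : EuclideanSpace ℝ (Fin d)) i ∂μ with hm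
  have hmT : ∀ i ≠ i0, |m i| ≤ C1 * T := fun i hi => by
    have h1 := m0 i hi
    have h2 : κ * (L - l2) * |m i| ≤ C0 * T := by
      refine le_trans ?_ h1
      rw [mul_assoc]
      have := hle2 i hi
      gcongr
    rw [hC1, div_mul_eq_mul_div, le_div_iff₀ hG]; linarith
  have hm1 : ∀ i, |m i| ≤ 1 := fun i => by
    have h1 : ‖m i‖ ≤ 1 * μ.real Set.univ :=
      norm_integral_le_of_norm_le_const (Eventually.of_forall fun x => coord_abs i x)
    simpa using h1
  set X : Fin d → Fin d → ℝ := fun i j => ∫ x : Sph d, (x : EuclideanSpace ℝ (Fin d)) j *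
    (x : EuclideanSpace ℝ (Fin d)) i ∂μ with hX
  have hXb : ∀ i ≠ i0, ∀ j ≠ i0, |ε * ((if j = i then 1 else 0) * (1 - D / 2))
      - κ * L * X i j| ≤ C2 * T := fun i hi j hj => by
    have h1 : |_ + κ * (lam i * (m j * m i) - L * X i j)| ≤ C0 * T := m1 i hi j hj
    have h2 : |κ * (lam i * (m j * m i))| ≤ κ * (L * (1 * (C1 * T))) := by
      rw [abs_mul, abs_mul, abs_mul, abs_of_pos hκ, abs_of_pos (hpos i)]
      have := hle i
      have := hm1 j
      have := hmT i hi
      gcongr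
    rw [hC2]
    rw [abs_le] at *
    constructor <;> linarith [h1.1, h1.2, h2.1, h2.2]
  have hr4 : ∫ x, rr s i0 x ^ 4 ∂μ ≤ 2 * T := by
    rw [hTdef, ← integral_const_mul]
    refine integral_mono (cint _ (by fun_prop)) (cint _ (by fun_prop)) fun x => ?_
    have h1 := rr_le_two hs i0 x
    have h2 := pow_nonneg (rr_nonneg s i0 x) 3
    change rr s i0 x ^ 4 ≤ 2 * rr s i0 x ^ 3
    nlinarith
  have hsum : ∑ i ∈ Finset.univ.erase i0, X i i = D - (∫ x, rr s i0 x ^ 4 ∂μ) / 4 := by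
    rw [hX]
    simp only
    have hint : ∀ i ∈ Finset.univ.erase i0, Integrable (fun x : Sph d =>
        (x : EuclideanSpace ℝ (Fin d)) i * (x : EuclideanSpace ℝ (Fin d)) i) μ :=
      fun i _ => cint _ ((coord_cont i).mul (coord_cont i))
    rw [← integral_finsetSum _ hint]
    have : ∀ x : Sph d, ∑ i ∈ Finset.univ.erase i0, (x : EuclideanSpace ℝ (Fin d)) i *
        (x : EuclideanSpace ℝ (Fin d)) i = rr s i0 x ^ 2 - rr s i0 x ^ 4 / 4 := fun x => by
      rw [← sum_erase_eq hs]; exact Finset.sum_congr rfl fun i _ => by ring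
    simp_rw [this]
    rw [integral_sub (cint _ (by fun_prop)) (cint _ (by fun_prop)), integral_div]
  have hsum2 : κ * L * ∑ i ∈ Finset.univ.erase i0, X i i ≤ d * (ε + C2 * T) := by
    rw [Finset.mul_sum]
    refine (Finset.sum_le_sum (g := fun _ => ε + C2 * T) fun i hi => ?_).trans ?_
    · have h := (abs_le.1 (hXb i (Finset.ne_of_mem_erase hi) i (Finset.ne_of_mem_erase hi))).1
      simp only [if_true, one_mul] at h
      linarith [mul_nonneg hε.le hD0]
    · rw [Finset.sum_const, nsmul_eq_mul]
      have : ((Finset.univ.erase i0).card : ℝ) ≤ d := by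
        have := Finset.card_erase_le (s := (Finset.univ : Finset (Fin d))) (a := i0)
        rw [Finset.card_univ, Fintype.card_fin] at this
        exact_mod_cast this
      have : 0 ≤ ε + C2 * T := by positivity
      gcongr
  have hD : D ≤ C3 * ε + C3 * T := by
    rw [hsum] at hsum2
    rw [hC3, ← mul_add, div_mul_eq_mul_div, le_div_iff₀ (by positivity)]
    have h1 : 0 ≤ κ * L := by positivity
    have h2 := mul_le_mul_of_nonneg_left hr4 h1
    have h3 : 0 ≤ (d : ℝ) * T := by positivity
    have h4 : 0 ≤ (d : ℝ) * C2 * ε := by positivity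
    have h5 : 0 ≤ κ * L * ε := by positivity
    linarith
  have hD2 : D ≤ (2 * C3 + 1) * ε := by
    have h1 : C3 * T ≤ C3 * (η * D + η * ε) := mul_le_mul_of_nonneg_left hT hC3p.le
    have h2 : C3 * η ≤ 1 / 2 := by linarith
    have h3 := mul_le_mul_of_nonneg_right h2 hD0
    have h4 := mul_le_mul_of_nonneg_right h2 hε.le
    linarith
  have hT2 : T ≤ η * (2 * C3 + 2) * ε := by
    have := mul_le_mul_of_nonneg_left hD2 hηp.le
    linarith
  have hT3 : T * (1 + C1 + 2 * C2) ≤ θ * ε := by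
    calc T * (1 + C1 + 2 * C2) ≤ (η * (2 * C3 + 2) * ε) * (1 + C1 + 2 * C2) := by gcongr
      _ = η * B * ε := by rw [hB]; ring
      _ ≤ θ * ε := by gcongr
  have p1 := mul_nonneg hT0 hC1p.le
  have p2 := mul_nonneg hT0 hC2p.le
  refine ⟨s, hs, by linarith, fun i hi => (hmT i hi).trans (by linarith), fun i hi j hj => ?_⟩
  have h := hXb i hi j hj
  have hδ : |ε * ((if j = i then 1 else 0) * (D / 2))| ≤ θ * ε / 2 := by
    have h1 : ε * D ≤ θ * ε := by
      have := mul_le_mul_of_nonneg_left hD2 hε.le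
      have := mul_le_mul_of_nonneg_right hε2 hε.le
      linarith
    split_ifs
    · rw [one_mul, abs_of_nonneg (by positivity)]; linarith
    · simp; positivity
  rw [abs_le] at *
  constructor <;> linarith [h.1, h.2, hδ.1, hδ.2]

/-- Gaussian factor -/
def gg (L s : ℝ) (i0 : Fin d) (x : Sph d) : ℝ := exp (-(L * rr s i0 x ^ 2 / 2))

lemma gg_cont (L s : ℝ) (i0 : Fin d) : Continuous (gg L s i0) := by
  unfold gg
  have := rr_cont s i0
  fun_prop

lemma gg_pos (L s : ℝ) (i0 : Fin d) (x : Sph d) : 0 < gg L s i0 x := exp_pos _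

lemma gg_le {L : ℝ} (hL : 0 < L) (s : ℝ) (i0 : Fin d) (x : Sph d) : gg L s i0 x ≤ 1 := by
  unfold gg
  rw [exp_le_one_iff]
  have : 0 ≤ L * rr s i0 x ^ 2 / 2 := by positivity
  linarith

lemma gg_sub (L s : ℝ) (i0 : Fin d) (x : Sph d) :
    1 - gg L s i0 x ≤ L * rr s i0 x ^ 2 / 2 := by
  unfold gg
  have := add_one_le_exp (-(L * rr s i0 x ^ 2 / 2))
  linarith

lemma exp_quad (w : ℝ) : |exp w - 1 - w| ≤ w ^ 2 * exp |w| := by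
  have h := Complex.norm_exp_sub_sum_le_norm_mul_exp (w : ℂ) 2
  simp only [Finset.sum_range_succ, Finset.sum_range_zero] at h
  have e : Complex.exp (w : ℂ) - (0 + (w : ℂ) ^ 0 / (Nat.factorial 0 : ℂ) +
      (w : ℂ) ^ 1 / (Nat.factorial 1 : ℂ)) = ((exp w - 1 - w : ℝ) : ℂ) := by
    push_cast
    simp
    ring
  rw [e] at h
  rw [Complex.norm_real, Complex.norm_real, Real.norm_eq_abs, Real.norm_eq_abs, sq_abs] at h
  exact h

/-- error constant -/
def CC (L : ℝ) : ℝ := exp L * (4 * L ^ 2 * exp (8 * L) + L)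

lemma K_exp {lam : Fin d → ℝ} {i0 : Fin d} (hpos : ∀ i, 0 < lam i) (hle : ∀ i, lam i ≤ lam i0)
    {s : ℝ} (hs : s ^ 2 = 1) (x y : Sph d) :
    |Kker lam x y - exp (lam i0) * (gg (lam i0) s i0 x * gg (lam i0) s i0 y) *
      (1 + zz lam i0 x y)| ≤ CC (lam i0) * (rr s i0 x ^ 2 * rr s i0 y ^ 2) := by
  have hL := hpos i0
  have hz := zz_abs hpos hle hs x y
  have hr := rr_nonneg s i0 x
  have hq := rr_nonneg s i0 y
  have hr2 := rr_le_two hs i0 x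
  have hq2 := rr_le_two hs i0 y
  have e : Kker lam x y = exp (lam i0) * (gg (lam i0) s i0 x * gg (lam i0) s i0 y) *
      exp (lam i0 * (rr s i0 x ^ 2 * rr s i0 y ^ 2) / 4 + zz lam i0 x y) := by
    unfold Kker gg
    rw [← exp_add, ← exp_add, ← exp_add, qA_eq lam hs i0 x y, aa_eq hs, aa_eq hs]
    congr 1
    ring
  have hg1 := gg_le hL s i0 x
  have hg2 := gg_le hL s i0 y
  have hg3 := gg_pos (lam i0) s i0 x
  have hg4 := gg_pos (lam i0) s i0 y
  rw [e, ← mul_sub, abs_mul, abs_of_pos (by positivity)]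
  unfold CC
  set L := lam i0
  set r := rr s i0 x
  set q := rr s i0 y
  set z := zz lam i0 x y
  obtain ⟨w, hw⟩ : ∃ w, w = L * (r ^ 2 * q ^ 2) / 4 + z := ⟨_, rfl⟩
  rw [← hw]
  have hrq : r * q ≤ 4 := by nlinarith
  have hrq0 : 0 ≤ r * q := mul_nonneg hr hq
  have h1 : |w| ≤ 2 * L * (r * q) := by
    rw [hw]
    refine (abs_add_le _ _).trans ?_
    rw [abs_of_nonneg (by positivity)]
    have : r ^ 2 * q ^ 2 ≤ 4 * (r * q) := by nlinarith
    have := mul_le_mul_of_nonneg_left this hL.le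
    linarith
  have h2 : |w| ≤ 8 * L := by
    have := mul_le_mul_of_nonneg_left hrq hL.le
    linarith
  have h3 : w ^ 2 ≤ 4 * L ^ 2 * (r ^ 2 * q ^ 2) := by
    rw [← sq_abs]
    calc |w| ^ 2 ≤ (2 * L * (r * q)) ^ 2 := by gcongr
      _ = _ := by ring
  have h4 : |exp w - 1 - w| ≤ 4 * L ^ 2 * (r ^ 2 * q ^ 2) * exp (8 * L) := by
    refine (exp_quad w).trans ?_
    gcongr
  have h5 : |exp w - (1 + z)| ≤ (4 * L ^ 2 * exp (8 * L) + L) * (r ^ 2 * q ^ 2) := by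
    have : exp w - (1 + z) = (exp w - 1 - w) + L * (r ^ 2 * q ^ 2) / 4 := by rw [hw]; ring
    rw [this]
    refine (abs_add_le _ _).trans ?_
    rw [abs_of_nonneg (show 0 ≤ L * (r ^ 2 * q ^ 2) / 4 by positivity)]
    have : 0 ≤ L * (r ^ 2 * q ^ 2) := by positivity
    linarith
  have h6 : gg L s i0 x * gg L s i0 y ≤ 1 := mul_le_one₀ hg1 hg4.le hg2
  calc exp L * (gg L s i0 x * gg L s i0 y) * |exp w - (1 + z)|
      ≤ exp L * 1 * ((4 * L ^ 2 * exp (8 * L) + L) * (r ^ 2 * q ^ 2)) := by gcongr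
    _ = _ := by ring

lemma cmul {μ : Measure (Sph d)} [IsProbabilityMeasure μ] {f h : Sph d → ℝ} (hf : Continuous f)
    (hh : Integrable h μ) : Integrable (fun x => f x * h x) μ := by
  obtain ⟨C, hC⟩ := (isCompact_univ.image hf).isBounded.exists_norm_le
  exact hh.bdd_mul hf.aestronglyMeasurable (Eventually.of_forall fun x => hC _ ⟨x, trivial, rfl⟩)

lemma quad {lam : Fin d → ℝ} {i0 : Fin d} (hpos : ∀ i, 0 < lam i) (hle : ∀ i, lam i ≤ lam i0)
    {s : ℝ} (hs : s ^ 2 = 1) {μ : Measure (Sph d)} [IsProbabilityMeasure μ] {h : Sph d → ℝ}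
    (hh : Integrable h μ) :
    |∫ x, ∫ y, Kker lam x y * h x * h y ∂μ ∂μ -
      exp (lam i0) * ((∫ x, gg (lam i0) s i0 x * h x ∂μ) ^ 2 +
        ∑ i ∈ Finset.univ.erase i0, lam i * (∫ x : Sph d, gg (lam i0) s i0 x *
          (x : EuclideanSpace ℝ (Fin d)) i * h x ∂μ) ^ 2)|
      ≤ CC (lam i0) * (∫ x, rr s i0 x ^ 2 * |h x| ∂μ) ^ 2 := by
  have hL := hpos i0
  set L := lam i0
  have hr := rr_cont s i0
  have hg := gg_cont L s i0
  have hF : Integrable (fun z : Sph d × Sph d => Kker lam z.1 z.2 * (h z.1 * h z.2))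
      (μ.prod μ) := by
    refine (hh.mul_prod hh).bdd_mul (c := exp L) (K_cont lam).aestronglyMeasurable
      (Eventually.of_forall fun z => ?_)
    rw [Real.norm_eq_abs, abs_of_pos (show 0 < Kker lam z.1 z.2 from exp_pos _)]
    exact K_le hpos hle z.1 z.2
  have e1 : ∫ x, ∫ y, Kker lam x y * h x * h y ∂μ ∂μ =
      ∫ z : Sph d × Sph d, Kker lam z.1 z.2 * (h z.1 * h z.2) ∂(μ.prod μ) := by
    rw [integral_prod _ hF]
    simp only [mul_assoc]
  have j0 : Integrable (fun x => gg L s i0 x * h x) μ := cmul hg hh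
  have ji : ∀ i, Integrable (fun x : Sph d => gg L s i0 x *
      (x : EuclideanSpace ℝ (Fin d)) i * h x) μ := fun i => cmul (hg.mul (coord_cont i)) hh
  have jr : Integrable (fun x => rr s i0 x ^ 2 * |h x|) μ := cmul (by fun_prop) hh.abs
  have hG1 := (j0.mul_prod j0)
  have hGi : ∀ i ∈ Finset.univ.erase i0, Integrable (fun z : Sph d × Sph d => lam i *
      ((gg L s i0 z.1 * (z.1 : EuclideanSpace ℝ (Fin d)) i * h z.1) *
      (gg L s i0 z.2 * (z.2 : EuclideanSpace ℝ (Fin d)) i * h z.2))) (μ.prod μ) :=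
    fun i _ => ((ji i).mul_prod (ji i)).const_mul _
  have hG : Integrable (fun z : Sph d × Sph d => exp L *
      ((gg L s i0 z.1 * h z.1) * (gg L s i0 z.2 * h z.2) + ∑ i ∈ Finset.univ.erase i0, lam i *
      ((gg L s i0 z.1 * (z.1 : EuclideanSpace ℝ (Fin d)) i * h z.1) *
      (gg L s i0 z.2 * (z.2 : EuclideanSpace ℝ (Fin d)) i * h z.2)))) (μ.prod μ) :=
    (hG1.add (integrable_finsetSum _ hGi)).const_mul (exp L)
  have e2 : exp L * ((∫ x, gg L s i0 x * h x ∂μ) ^ 2 +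
        ∑ i ∈ Finset.univ.erase i0, lam i * (∫ x : Sph d, gg L s i0 x *
          (x : EuclideanSpace ℝ (Fin d)) i * h x ∂μ) ^ 2) = ∫ z : Sph d × Sph d, exp L *
      ((gg L s i0 z.1 * h z.1) * (gg L s i0 z.2 * h z.2) + ∑ i ∈ Finset.univ.erase i0, lam i *
      ((gg L s i0 z.1 * (z.1 : EuclideanSpace ℝ (Fin d)) i * h z.1) *
      (gg L s i0 z.2 * (z.2 : EuclideanSpace ℝ (Fin d)) i * h z.2))) ∂(μ.prod μ) := by
    rw [integral_const_mul, integral_add hG1 (integrable_finsetSum _ hGi),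
      integral_finsetSum _ hGi, integral_prod_mul (fun x => gg L s i0 x * h x)
      (fun x => gg L s i0 x * h x)]
    congr 2
    · ring
    · refine Finset.sum_congr rfl fun i _ => ?_
      rw [integral_const_mul, integral_prod_mul (fun x : Sph d => gg L s i0 x *
          (x : EuclideanSpace ℝ (Fin d)) i * h x) (fun x : Sph d => gg L s i0 x *
          (x : EuclideanSpace ℝ (Fin d)) i * h x)]
      ring
  have e3 : CC L * (∫ x, rr s i0 x ^ 2 * |h x| ∂μ) ^ 2 = ∫ z : Sph d × Sph d, CC L *
      ((rr s i0 z.1 ^ 2 * |h z.1|) * (rr s i0 z.2 ^ 2 * |h z.2|)) ∂(μ.prod μ) := by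
    rw [integral_const_mul, integral_prod_mul (fun x => rr s i0 x ^ 2 * |h x|)
      (fun x => rr s i0 x ^ 2 * |h x|)]
    ring
  rw [e1, e2, e3, ← integral_sub hF hG]
  refine abs_integral_le_integral_abs.trans (integral_mono (hF.sub hG).abs
    ((jr.mul_prod jr).const_mul _) fun z => ?_)
  have hk := K_exp hpos hle hs z.1 z.2
  have hk2 := mul_le_mul_of_nonneg_right hk (abs_nonneg (h z.1 * h z.2))
  rw [← abs_mul] at hk2
  refine le_trans (le_of_eq ?_) (hk2.trans (le_of_eq ?_))
  · change |_| = _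
    congr 1
    rw [sub_mul]
    congr 1
    unfold zz
    have : ∑ i ∈ Finset.univ.erase i0, lam i *
      ((gg L s i0 z.1 * (z.1 : EuclideanSpace ℝ (Fin d)) i * h z.1) *
      (gg L s i0 z.2 * (z.2 : EuclideanSpace ℝ (Fin d)) i * h z.2)) =
      (gg L s i0 z.1 * gg L s i0 z.2 * (h z.1 * h z.2)) * ∑ i ∈ Finset.univ.erase i0,
    lam i * (z.1 : EuclideanSpace ℝ (Fin d)) i * (z.2 : EuclideanSpace ℝ (Fin d)) i := by
      rw [Finset.mul_sum]
      exact Finset.sum_congr rfl fun i _ => by ring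
    rw [this]
    ring
  · rw [abs_mul]
    change _ = CC L * _
    ring

lemma cs {μ : Measure (Sph d)} [IsProbabilityMeasure μ] {f h : Sph d → ℝ} (hf : Continuous f)
    (hh : Integrable h μ) (hh2 : Integrable (fun x => h x ^ 2) μ) :
    (∫ x, f x * h x ∂μ) ^ 2 ≤ (∫ x, f x ^ 2 ∂μ) * ∫ x, h x ^ 2 ∂μ := by
  have i1 : Integrable (fun x => f x ^ 2) μ := cint μ (by fun_prop)
  have i2 := cmul hf hh
  have key : ∀ t : ℝ, 0 ≤ (∫ x, f x ^ 2 ∂μ) * (t * t) + (-2 * ∫ x, f x * h x ∂μ) * t +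
      ∫ x, h x ^ 2 ∂μ := fun t => by
    have h0 : 0 ≤ ∫ x, (t * f x - h x) ^ 2 ∂μ := integral_nonneg fun x => sq_nonneg _
    have e : ∀ x, (t * f x - h x) ^ 2 = t ^ 2 * f x ^ 2 - 2 * t * (f x * h x) + h x ^ 2 :=
      fun x => by ring
    simp_rw [e] at h0
    have i3 : Integrable (fun x => t ^ 2 * f x ^ 2 - 2 * t * (f x * h x)) μ :=
      (i1.const_mul _).sub (i2.const_mul _)
    rw [integral_add i3 hh2,
      integral_sub (i1.const_mul _) (i2.const_mul _), integral_const_mul, integral_const_mul] at h0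
    linarith
  have := discrim_le_zero key
  unfold discrim at this
  linarith

lemma r4 {s : ℝ} (hs : s ^ 2 = 1) (i0 : Fin d) (μ : Measure (Sph d)) [IsProbabilityMeasure μ] :
    ∫ x, (rr s i0 x ^ 2) ^ 2 ∂μ ≤ 2 * ∫ x, rr s i0 x ^ 3 ∂μ := by
  have hr := rr_cont s i0
  rw [← integral_const_mul]
  refine integral_mono (cint _ (by fun_prop)) (cint _ (by fun_prop)) fun x => ?_
  have h1 := rr_le_two hs i0 x
  have h2 := pow_nonneg (rr_nonneg s i0 x) 3
  change (rr s i0 x ^ 2) ^ 2 ≤ 2 * rr s i0 x ^ 3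
  nlinarith

lemma P_bd {s : ℝ} (hs : s ^ 2 = 1) (i0 : Fin d) (μ : Measure (Sph d)) [IsProbabilityMeasure μ]
    {h : Sph d → ℝ} (hh : Integrable h μ) (hh2 : Integrable (fun x => h x ^ 2) μ) :
    (∫ x, rr s i0 x ^ 2 * |h x| ∂μ) ^ 2 ≤
      2 * (∫ x, rr s i0 x ^ 3 ∂μ) * ∫ x, h x ^ 2 ∂μ := by
  have hr := rr_cont s i0
  have h1 := cs (μ := μ) (f := fun x => rr s i0 x ^ 2) (by fun_prop) hh.abs (by simpa using hh2)
  simp only [sq_abs] at h1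
  refine h1.trans (mul_le_mul_of_nonneg_right (r4 hs i0 μ) (integral_nonneg fun x => sq_nonneg _))

lemma A_bd {L s : ℝ} (hL : 0 < L) (hs : s ^ 2 = 1) (i0 : Fin d) (μ : Measure (Sph d))
    [IsProbabilityMeasure μ] {h : Sph d → ℝ} (hh : Integrable h μ)
    (hh2 : Integrable (fun x => h x ^ 2) μ) (h0 : ∫ x, h x ∂μ = 0) :
    (∫ x, gg L s i0 x * h x ∂μ) ^ 2 ≤
      L ^ 2 / 2 * (∫ x, rr s i0 x ^ 3 ∂μ) * ∫ x, h x ^ 2 ∂μ := by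
  have hr := rr_cont s i0
  have hg := gg_cont L s i0
  have e : (∫ x, gg L s i0 x * h x ∂μ) = - ∫ x, (1 - gg L s i0 x) * h x ∂μ := by
    have : ∀ x, (1 - gg L s i0 x) * h x = h x - gg L s i0 x * h x := fun x => by ring
    simp_rw [this]
    rw [integral_sub hh (cmul hg hh), h0]; ring
  rw [e, neg_sq]
  refine (cs (f := fun x => 1 - gg L s i0 x) (by fun_prop) hh hh2).trans
    (mul_le_mul_of_nonneg_right ?_ (integral_nonneg fun x => sq_nonneg _))
  have h1 : ∫ x, (1 - gg L s i0 x) ^ 2 ∂μ ≤ ∫ x, L ^ 2 / 4 * (rr s i0 x ^ 2) ^ 2 ∂μ := by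
    refine integral_mono (cint _ (by fun_prop)) (cint _ (by fun_prop)) fun x => ?_
    have h1 := gg_sub L s i0 x
    have h2 := gg_le hL s i0 x
    change (1 - gg L s i0 x) ^ 2 ≤ L ^ 2 / 4 * (rr s i0 x ^ 2) ^ 2
    have h3 : 0 ≤ 1 - gg L s i0 x := by linarith
    calc (1 - gg L s i0 x) ^ 2 ≤ (L * rr s i0 x ^ 2 / 2) ^ 2 := by gcongr
      _ = _ := by ring
  rw [integral_const_mul] at h1
  have h2 := mul_le_mul_of_nonneg_left (r4 hs i0 μ) (show 0 ≤ L ^ 2 / 4 by positivity)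
  linarith

/-- bound of the transversal part -/
lemma Q_bd {L s k ε θ : ℝ} (hL : 0 < L) (hk : 0 < k) (hε : 0 < ε) (hθ : 0 < θ)
    (i0 : Fin d) (μ : Measure (Sph d))
    [IsProbabilityMeasure μ] {h : Sph d → ℝ} (hh : Integrable h μ)
    (hh2 : Integrable (fun x => h x ^ 2) μ)
    (hX : ∀ i ≠ i0, ∀ j ≠ i0, |k *
          (∫ x : Sph d, (x : EuclideanSpace ℝ (Fin d)) j * (x : EuclideanSpace ℝ (Fin d)) i ∂μ)
          - ε * (if j = i then 1 else 0)| ≤ θ * ε) :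
    k * ∑ i ∈ Finset.univ.erase i0, (∫ x : Sph d, gg L s i0 x *
          (x : EuclideanSpace ℝ (Fin d)) i * h x ∂μ) ^ 2 ≤
      (1 + d * θ) * ε * ∫ x, h x ^ 2 ∂μ := by
  have hg := gg_cont L s i0
  set c : Fin d → ℝ := fun i => ∫ x : Sph d, gg L s i0 x *
          (x : EuclideanSpace ℝ (Fin d)) i * h x ∂μ with hc
  set N := ∫ x, h x ^ 2 ∂μ with hN
  have hN0 : 0 ≤ N := integral_nonneg fun x => sq_nonneg _
  set E := Finset.univ.erase i0 with hE
  obtain ⟨Q, hQ⟩ : ∃ Q, Q = ∑ i ∈ E, c i ^ 2 := ⟨_, rfl⟩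
  have hQ0 : 0 ≤ Q := by rw [hQ]; exact Finset.sum_nonneg fun i _ => sq_nonneg _
  set f : Sph d → ℝ := fun x => ∑ i ∈ E, c i * (x : EuclideanSpace ℝ (Fin d)) i with hf
  have hfc : Continuous f := continuous_finsetSum _ fun i _ =>
    continuous_const.mul (coord_cont i)
  have e1 : Q = ∫ x, (gg L s i0 x * f x) * h x ∂μ := by
    have : ∀ x : Sph d, (gg L s i0 x * f x) * h x = ∑ i ∈ E, c i * (gg L s i0 x *
        (x : EuclideanSpace ℝ (Fin d)) i * h x) := fun x => by
      rw [hf]; simp only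
      rw [Finset.mul_sum, Finset.sum_mul]
      exact Finset.sum_congr rfl fun i _ => by ring
    simp_rw [this]
    have hint : ∀ i ∈ E, Integrable (fun x : Sph d => c i * (gg L s i0 x *
        (x : EuclideanSpace ℝ (Fin d)) i * h x)) μ :=
      fun i _ => (cmul (hg.mul (coord_cont i)) hh).const_mul _
    rw [integral_finsetSum _ hint, hQ]
    refine Finset.sum_congr rfl fun i _ => ?_
    rw [integral_const_mul, sq]
  have e2 : Q ^ 2 ≤ (∫ x, f x ^ 2 ∂μ) * N := by
    rw [e1]
    refine (cs (hg.mul hfc) hh hh2).trans (mul_le_mul_of_nonneg_right ?_ hN0)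
    refine integral_mono (cint _ ((hg.mul hfc).pow 2)) (cint _ (hfc.pow 2)) fun x => ?_
    change (gg L s i0 x * f x) ^ 2 ≤ f x ^ 2
    rw [mul_pow]
    exact mul_le_of_le_one_left (sq_nonneg _)
      (pow_le_one₀ (gg_pos L s i0 x).le (gg_le hL s i0 x))
  have e3 : k * ∫ x, f x ^ 2 ∂μ ≤ (1 + d * θ) * ε * Q := by
    have h1 : ∀ x : Sph d, f x ^ 2 = ∑ i ∈ E, ∑ j ∈ E, c i * c j *
        ((x : EuclideanSpace ℝ (Fin d)) j * (x : EuclideanSpace ℝ (Fin d)) i) := fun x => by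
      rw [hf]; simp only
      rw [sq, Finset.sum_mul_sum]
      exact Finset.sum_congr rfl fun i _ => Finset.sum_congr rfl fun j _ => by ring
    simp_rw [h1]
    have hint : ∀ i ∈ E, ∀ j ∈ E, Integrable (fun x : Sph d => c i * c j *
        ((x : EuclideanSpace ℝ (Fin d)) j * (x : EuclideanSpace ℝ (Fin d)) i)) μ :=
      fun i _ j _ => cint _ (continuous_const.mul ((coord_cont j).mul (coord_cont i)))
    rw [integral_finsetSum _ (fun i hi => integrable_finsetSum _ (hint i hi)), Finset.mul_sum]
    have h2 : ∀ i ∈ E, k * ∫ x : Sph d, ∑ j ∈ E, c i * c j *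
        ((x : EuclideanSpace ℝ (Fin d)) j * (x : EuclideanSpace ℝ (Fin d)) i) ∂μ ≤
        ε * c i ^ 2 + θ * ε * (|c i| * ∑ j ∈ E, |c j|) := fun i hi => by
      rw [integral_finsetSum _ (hint i hi), Finset.mul_sum]
      have h3 : ε * c i ^ 2 + θ * ε * (|c i| * ∑ j ∈ E, |c j|) =
          ∑ j ∈ E, ((if j = i then ε * (c i * c j) else 0) + θ * ε * (|c i| * |c j|)) := by
        rw [Finset.sum_add_distrib, Finset.sum_ite_eq' E i, if_pos hi, Finset.mul_sum,
          Finset.mul_sum, sq]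
      rw [h3]
      refine Finset.sum_le_sum fun j hj => ?_
      rw [integral_const_mul]
      have h4 := hX i (Finset.ne_of_mem_erase hi) j (Finset.ne_of_mem_erase hj)
      set X := ∫ x : Sph d, (x : EuclideanSpace ℝ (Fin d)) j *
        (x : EuclideanSpace ℝ (Fin d)) i ∂μ
      have h5 := mul_le_mul_of_nonneg_left h4 (abs_nonneg (c i * c j))
      rw [← abs_mul] at h5
      have h6 := (le_abs_self _).trans h5
      rw [abs_mul] at h6
      split_ifs at h6 ⊢ <;> linarith
    refine (Finset.sum_le_sum h2).trans ?_
    rw [Finset.sum_add_distrib, ← Finset.mul_sum, ← hQ, ← Finset.mul_sum, ← Finset.sum_mul, ← sq]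
    have h7 : (∑ j ∈ E, |c j|) ^ 2 ≤ d * Q := by
      refine (sq_sum_le_card_mul_sum_sq).trans ?_
      simp only [sq_abs]
      rw [← hQ]
      have : ((Finset.univ.erase i0).card : ℝ) ≤ d := by
        have := Finset.card_erase_le (s := (Finset.univ : Finset (Fin d))) (a := i0)
        rw [Finset.card_univ, Fintype.card_fin] at this
        exact_mod_cast this
      gcongr
    have h8 := mul_le_mul_of_nonneg_left h7 (show 0 ≤ θ * ε by positivity)
    linarith
  change k * ∑ i ∈ E, c i ^ 2 ≤ _
  rw [← hQ]
  rcases hQ0.eq_or_lt with h0 | h0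
  · rw [← h0, mul_zero]; positivity
  · have h1 := mul_le_mul_of_nonneg_left e2 hk.le
    have h2 := mul_le_mul_of_nonneg_right e3 hN0
    refine le_of_mul_le_mul_right ?_ h0
    linarith

theorem part_i {lam : Fin d → ℝ} {i0 : Fin d} (hpos : ∀ i, 0 < lam i) {l2 : ℝ} (hl20 : 0 < l2)
    (hl2 : l2 < lam i0) (hle2 : ∀ i ≠ i0, lam i ≤ l2) {ε θ γ s : ℝ} (hε : 0 < ε) (hθ : 0 < θ)
    (hs : s ^ 2 = 1) (μ : Measure (Sph d)) [IsProbabilityMeasure μ]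
    (hT : ∫ x, rr s i0 x ^ 3 ∂μ ≤ θ * ε)
    (hX : ∀ i ≠ i0, ∀ j ≠ i0, |exp (lam i0) * lam i0 *
          (∫ x : Sph d, (x : EuclideanSpace ℝ (Fin d)) j * (x : EuclideanSpace ℝ (Fin d)) i ∂μ)
          - ε * (if j = i then 1 else 0)| ≤ θ * ε)
    (hγ : θ * (exp (lam i0) * lam i0 ^ 2 / 2 + 2 * CC (lam i0) + l2 * d / lam i0) ≤ γ)
    {h : Sph d → ℝ} (hm : Measurable h) (hh2 : Integrable (fun x => h x ^ 2) μ)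
    (h0 : ∫ x, h x ∂μ = 0) :
    ∫ x, ∫ y, Kker lam x y * h x * h y ∂μ ∂μ ≤ (l2 / lam i0 + γ) * ε * ∫ x, h x ^ 2 ∂μ := by
  have hL := hpos i0
  have hle : ∀ i, lam i ≤ lam i0 := fun i => by
    by_cases h : i = i0
    · rw [h]
    · exact (hle2 i h).trans hl2.le
  have hh : Integrable h μ :=
    ((memLp_two_iff_integrable_sq hm.aestronglyMeasurable).2 hh2).integrable (by norm_num)
  have q := (abs_le.1 (quad hpos hle hs hh)).2
  have hκ := exp_pos (lam i0)
  have hA := A_bd hL hs i0 μ hh hh2 h0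
  have hP := P_bd hs i0 μ hh hh2
  have hQ := Q_bd (s := s) hL (mul_pos hκ hL) hε hθ i0 μ hh hh2 hX
  have hCC : 0 < CC (lam i0) := by unfold CC; positivity
  have hN0 : 0 ≤ ∫ x, h x ^ 2 ∂μ := integral_nonneg fun x => sq_nonneg _
  have hsum : ∑ i ∈ Finset.univ.erase i0, lam i * (∫ x : Sph d, gg (lam i0) s i0 x *
          (x : EuclideanSpace ℝ (Fin d)) i * h x ∂μ) ^ 2 ≤
      l2 * ∑ i ∈ Finset.univ.erase i0, (∫ x : Sph d, gg (lam i0) s i0 x *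
          (x : EuclideanSpace ℝ (Fin d)) i * h x ∂μ) ^ 2 := by
    rw [Finset.mul_sum]
    exact Finset.sum_le_sum fun i hi =>
      mul_le_mul_of_nonneg_right (hle2 i (Finset.ne_of_mem_erase hi)) (sq_nonneg _)
  generalize (∑ i ∈ Finset.univ.erase i0, lam i * (∫ x : Sph d, gg (lam i0) s i0 x *
          (x : EuclideanSpace ℝ (Fin d)) i * h x ∂μ) ^ 2) = S1 at *
  generalize (∑ i ∈ Finset.univ.erase i0, (∫ x : Sph d, gg (lam i0) s i0 x *
          (x : EuclideanSpace ℝ (Fin d)) i * h x ∂μ) ^ 2) = Q at *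
  generalize ∫ x, ∫ y, Kker lam x y * h x * h y ∂μ ∂μ = J at *
  generalize (∫ x, gg (lam i0) s i0 x * h x ∂μ) = a at *
  generalize (∫ x, rr s i0 x ^ 2 * |h x| ∂μ) = P at *
  generalize (∫ x, rr s i0 x ^ 3 ∂μ) = T at *
  generalize (∫ x, h x ^ 2 ∂μ) = N at *
  generalize CC (lam i0) = C at *
  generalize exp (lam i0) = κ at *
  generalize lam i0 = L at *
  have hTN : T * N ≤ θ * ε * N := mul_le_mul_of_nonneg_right hT hN0
  have b1 : κ * a ^ 2 ≤ κ * (L ^ 2 / 2 * (θ * ε * N)) := by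
    refine mul_le_mul_of_nonneg_left (hA.trans ?_) hκ.le
    rw [mul_assoc]
    exact mul_le_mul_of_nonneg_left hTN (by positivity)
  have b2 : C * P ^ 2 ≤ C * (2 * (θ * ε * N)) :=
    mul_le_mul_of_nonneg_left (hP.trans (by linarith)) hCC.le
  have b3 : κ * S1 ≤ l2 / L * ((1 + d * θ) * ε * N) := by
    calc κ * S1 ≤ κ * (l2 * Q) := mul_le_mul_of_nonneg_left hsum hκ.le
      _ = l2 / L * (κ * L * Q) := by field_simp
      _ ≤ _ := mul_le_mul_of_nonneg_left hQ (by positivity)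
  have b4 := mul_le_mul_of_nonneg_right hγ (mul_nonneg hε.le hN0)
  have e : l2 / L * ((1 + d * θ) * ε * N) = l2 / L * ε * N + θ * (l2 * d / L) * (ε * N) := by ring
  linarith

theorem part_ii {lam : Fin d → ℝ} {i0 i1 : Fin d} (hpos : ∀ i, 0 < lam i) (hi : i1 ≠ i0)
    (hle : ∀ i, lam i ≤ lam i0) {ε θ γ s : ℝ} (hε : 0 < ε)
    (hs : s ^ 2 = 1) (μ : Measure (Sph d)) [IsProbabilityMeasure μ]
    (hT : ∫ x, rr s i0 x ^ 3 ∂μ ≤ θ * ε)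
    (hm : |∫ x : Sph d, (x : EuclideanSpace ℝ (Fin d)) i1 ∂μ| ≤ θ * ε)
    (hX : |exp (lam i0) * lam i0 *
          (∫ x : Sph d, (x : EuclideanSpace ℝ (Fin d)) i1 * (x : EuclideanSpace ℝ (Fin d)) i1 ∂μ)
          - ε| ≤ θ * ε)
    (hγ : θ * (lam i1 * (1 + exp (lam i0) * lam i0) / lam i0 + 2 * exp (lam i0) * lam i1 * lam i0
      + 2 * CC (lam i0)) ≤ γ) (hθ2 : θ * (1 + exp (lam i0) * lam i0) < 1) :
    ∃ h : Sph d → ℝ, Measurable h ∧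
          Integrable (fun x => h x ^ 2) μ ∧
          0 < ∫ x, h x ^ 2 ∂μ ∧
          (∫ x, h x ∂μ) = 0 ∧
          (lam i1 / lam i0 - γ) * ε * ∫ x, h x ^ 2 ∂μ ≤
            ∫ x, ∫ y, Kker lam x y * h x * h y ∂μ ∂μ := by
  have hL := hpos i0
  have hl2 := hpos i1
  have hκ := exp_pos (lam i0)
  have hr := rr_cont s i0
  have hg := gg_cont (lam i0) s i0
  have hxc := coord_cont (d := d) i1
  set m := ∫ x : Sph d, (x : EuclideanSpace ℝ (Fin d)) i1 ∂μ with hmdef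
  have hm1 : |m| ≤ 1 := by
    have h1 : ‖m‖ ≤ 1 * μ.real Set.univ :=
      norm_integral_le_of_norm_le_const (Eventually.of_forall fun x => coord_abs i1 x)
    simpa using h1
  obtain ⟨h, hh⟩ : ∃ h : Sph d → ℝ, h = fun x : Sph d => (x : EuclideanSpace ℝ (Fin d)) i1 - m := ⟨_, rfl⟩
  have hhc : Continuous h := by rw [hh]; exact hxc.sub continuous_const
  have h0 : ∫ x, h x ∂μ = 0 := by
    rw [hh, integral_sub (cint _ hxc) (integrable_const _)]; simp [hmdef]
  have hh2 : Integrable (fun x => h x ^ 2) μ := cint _ (hhc.pow 2)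
  have ixx : Integrable (fun x : Sph d => (x : EuclideanSpace ℝ (Fin d)) i1 *
      (x : EuclideanSpace ℝ (Fin d)) i1) μ := cint _ (hxc.mul hxc)
  have ixh : Integrable (fun x : Sph d => (x : EuclideanSpace ℝ (Fin d)) i1 * h x) μ :=
    cint _ (hxc.mul hhc)
  have igxh : Integrable (fun x : Sph d => gg (lam i0) s i0 x *
      (x : EuclideanSpace ℝ (Fin d)) i1 * h x) μ := cint _ ((hg.mul hxc).mul hhc)
  have hxh : ∫ x : Sph d, (x : EuclideanSpace ℝ (Fin d)) i1 * h x ∂μ = ∫ x, h x ^ 2 ∂μ := by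
    have : ∀ x : Sph d, (x : EuclideanSpace ℝ (Fin d)) i1 * h x = h x ^ 2 + m * h x :=
      fun x => by rw [hh]; ring
    simp_rw [this]
    rw [integral_add hh2 ((cint _ hhc).const_mul m), integral_const_mul, h0]
    simp
  have hV : ∫ x, h x ^ 2 ∂μ = (∫ x : Sph d, (x : EuclideanSpace ℝ (Fin d)) i1 *
      (x : EuclideanSpace ℝ (Fin d)) i1 ∂μ) - m ^ 2 := by
    rw [← hxh]
    have : ∀ x : Sph d, (x : EuclideanSpace ℝ (Fin d)) i1 * h x =
      (x : EuclideanSpace ℝ (Fin d)) i1 * (x : EuclideanSpace ℝ (Fin d)) i1 -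
      m * (x : EuclideanSpace ℝ (Fin d)) i1 := fun x => by rw [hh]; ring
    simp_rw [this]
    rw [integral_sub ixx ((cint _ hxc).const_mul m), integral_const_mul]
    rw [← hmdef]; ring
  have hVlow : ε * (1 - θ * (1 + exp (lam i0) * lam i0)) ≤
      exp (lam i0) * lam i0 * ∫ x, h x ^ 2 ∂μ := by
    rw [hV]
    have h1 := (abs_le.1 hX).1
    have h2 : m ^ 2 ≤ θ * ε := by
      rw [← sq_abs]
      nlinarith [abs_nonneg m]
    have h3 := mul_le_mul_of_nonneg_left h2 (mul_pos hκ hL).le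
    linarith
  have hc1 : |(∫ x : Sph d, gg (lam i0) s i0 x * (x : EuclideanSpace ℝ (Fin d)) i1 * h x ∂μ) -
      ∫ x, h x ^ 2 ∂μ| ≤ lam i0 * (θ * ε) := by
    rw [← hxh, ← integral_sub igxh ixh]
    refine abs_integral_le_integral_abs.trans ?_
    have : ∫ x, lam i0 * rr s i0 x ^ 3 ∂μ ≤ lam i0 * (θ * ε) := by
      rw [integral_const_mul]; exact mul_le_mul_of_nonneg_left hT hL.le
    refine le_trans (integral_mono (cint _ (by fun_prop)) (cint _ (by fun_prop)) fun x => ?_) this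
    change |gg (lam i0) s i0 x * (x : EuclideanSpace ℝ (Fin d)) i1 * h x -
      (x : EuclideanSpace ℝ (Fin d)) i1 * h x| ≤ lam i0 * rr s i0 x ^ 3
    have e : gg (lam i0) s i0 x * (x : EuclideanSpace ℝ (Fin d)) i1 * h x -
      (x : EuclideanSpace ℝ (Fin d)) i1 * h x = -((1 - gg (lam i0) s i0 x) *
        (x : EuclideanSpace ℝ (Fin d)) i1 * h x) := by ring
    have g1 := gg_le hL s i0 x
    have g2 := gg_sub (lam i0) s i0 x
    have g3 : |h x| ≤ 2 := by
      rw [hh]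
      have := abs_sub ((x : EuclideanSpace ℝ (Fin d)) i1) m
      have := coord_abs i1 x
      simp only
      linarith
    have g4 := coord_le_rr hs i0 hi x
    have g5 := rr_nonneg s i0 x
    rw [e, abs_neg, abs_mul, abs_mul, abs_of_nonneg (show 0 ≤ 1 - gg (lam i0) s i0 x by linarith)]
    calc (1 - gg (lam i0) s i0 x) * |(x : EuclideanSpace ℝ (Fin d)) i1| * |h x|
        ≤ (lam i0 * rr s i0 x ^ 2 / 2) * rr s i0 x * 2 := by gcongr
      _ = _ := by ring
  have hVpos : 0 < ∫ x, h x ^ 2 ∂μ := by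
    have : 0 < ε * (1 - θ * (1 + exp (lam i0) * lam i0)) := mul_pos hε (by linarith)
    exact pos_of_mul_pos_right (this.trans_le hVlow) (mul_pos hκ hL).le
  refine ⟨h, hhc.measurable, hh2, hVpos, h0, ?_⟩
  have q := (abs_le.1 (quad hpos hle hs (cint μ hhc))).1
  have hP := P_bd hs i0 μ (cint μ hhc) hh2
  have hCC : 0 < CC (lam i0) := by unfold CC; positivity
  have hsum : lam i1 * (∫ x : Sph d, gg (lam i0) s i0 x *
          (x : EuclideanSpace ℝ (Fin d)) i1 * h x ∂μ) ^ 2 ≤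
      ∑ i ∈ Finset.univ.erase i0, lam i * (∫ x : Sph d, gg (lam i0) s i0 x *
          (x : EuclideanSpace ℝ (Fin d)) i * h x ∂μ) ^ 2 :=
    Finset.single_le_sum (f := fun i => lam i * (∫ x : Sph d, gg (lam i0) s i0 x *
          (x : EuclideanSpace ℝ (Fin d)) i * h x ∂μ) ^ 2)
      (fun i _ => mul_nonneg (hpos i).le (sq_nonneg _)) (Finset.mem_erase.2 ⟨hi, Finset.mem_univ _⟩)
  clear hV hxh h0 hh2 ixx ixh igxh hmdef hm hX hm1
  generalize (∑ i ∈ Finset.univ.erase i0, lam i * (∫ x : Sph d, gg (lam i0) s i0 x *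
          (x : EuclideanSpace ℝ (Fin d)) i * h x ∂μ) ^ 2) = S1 at *
  generalize ∫ x, ∫ y, Kker lam x y * h x * h y ∂μ ∂μ = J at *
  generalize (∫ x : Sph d, gg (lam i0) s i0 x *
          (x : EuclideanSpace ℝ (Fin d)) i1 * h x ∂μ) = c at *
  generalize (∫ x, gg (lam i0) s i0 x * h x ∂μ) = a at *
  generalize (∫ x, rr s i0 x ^ 2 * |h x| ∂μ) = P at *
  generalize (∫ x, rr s i0 x ^ 3 ∂μ) = T at *
  generalize (∫ x, h x ^ 2 ∂μ) = V at *
  generalize CC (lam i0) = C at *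
  generalize exp (lam i0) = κ at *
  generalize lam i0 = L at *
  generalize lam i1 = l at *
  have b1 : C * P ^ 2 ≤ C * (2 * (θ * ε) * V) :=
    mul_le_mul_of_nonneg_left (hP.trans (mul_le_mul_of_nonneg_right (by linarith) hVpos.le)) hCC.le
  have b2 : V ^ 2 - 2 * (L * (θ * ε)) * V ≤ c ^ 2 := by
    have h1 := mul_le_mul_of_nonneg_right (abs_le.1 hc1).1 hVpos.le
    nlinarith [sq_nonneg (c - V)]
  have b3 := mul_le_mul_of_nonneg_left b2 (mul_pos hκ hl2).le
  have b4 : l / L * (ε * (1 - θ * (1 + κ * L))) * V ≤ κ * l * V ^ 2 := by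
    have := mul_le_mul_of_nonneg_right
      (mul_le_mul_of_nonneg_left hVlow (div_pos hl2 hL).le) hVpos.le
    refine this.trans (le_of_eq ?_)
    field_simp
  have b5 := mul_le_mul_of_nonneg_right hγ (mul_pos hε hVpos).le
  have b6 := mul_le_mul_of_nonneg_left hsum hκ.le
  have b7 : 0 ≤ κ * a ^ 2 := by positivity
  have e : θ * (l * (1 + κ * L) / L) * (ε * V) = l / L * (ε * (θ * (1 + κ * L))) * V := by ring
  linarith

/-- sharp chord/Hessian-kernel operator scale at global minimizers. -/
theorem stmt10 (d : ℕ) (hd : 2 ≤ d) (lam : Fin d → ℝ)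
    (hanti : Antitone lam)
    (hgap : lam ⟨1, by omega⟩ < lam ⟨0, by omega⟩)
    (hpos : ∀ i, 0 < lam i)
    (ω : Measure (Sph d)) (hω : IsUniform ω)
    (γ : ℝ) (hγ : 0 < γ) :
    ∃ ε₀ : ℝ, 0 < ε₀ ∧ ∀ ε : ℝ, 0 < ε → ε < ε₀ →
      ∀ μbar : Measure (Sph d), IsMinimizer lam ω ε μbar →
        (∀ h : Sph d → ℝ, Measurable h →
          Integrable (fun x => h x ^ 2) μbar →
          (∫ x, h x ∂μbar) = 0 →
          ∫ x, ∫ y, Kker lam x y * h x * h y ∂μbar ∂μbar ≤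
            (lam ⟨1, by omega⟩ / lam ⟨0, by omega⟩ + γ) * ε * ∫ x, h x ^ 2 ∂μbar) ∧
        (∃ h : Sph d → ℝ, Measurable h ∧
          Integrable (fun x => h x ^ 2) μbar ∧
          0 < ∫ x, h x ^ 2 ∂μbar ∧
          (∫ x, h x ∂μbar) = 0 ∧
          (lam ⟨1, by omega⟩ / lam ⟨0, by omega⟩ - γ) * ε * ∫ x, h x ^ 2 ∂μbar ≤
            ∫ x, ∫ y, Kker lam x y * h x * h y ∂μbar ∂μbar) := by
  have hd0 : 0 < d := by omega
  have hd1 : 1 < d := by omega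
  have hi : (⟨1, hd1⟩ : Fin d) ≠ ⟨0, hd0⟩ := by
    intro h; simp [Fin.ext_iff] at h
  have hle2 : ∀ i ≠ (⟨0, hd0⟩ : Fin d), lam i ≤ lam ⟨1, hd1⟩ := fun i hne => hanti (by
    rw [Fin.le_def]
    have : i.val ≠ 0 := fun h => hne (Fin.ext h)
    change 1 ≤ i.val
    omega)
  have hle : ∀ i, lam i ≤ lam ⟨0, hd0⟩ := fun i => hanti (by rw [Fin.le_def]; exact Nat.zero_le _)
  change lam ⟨1, hd1⟩ < lam ⟨0, hd0⟩ at hgap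
  have hL := hpos ⟨0, hd0⟩
  have hl := hpos ⟨1, hd1⟩
  have hCC : 0 < CC (lam ⟨0, hd0⟩) := by unfold CC; positivity
  obtain ⟨B1, hB1⟩ : ∃ B1, B1 = exp (lam ⟨0, hd0⟩) * lam ⟨0, hd0⟩ ^ 2 / 2 + 2 * CC (lam ⟨0, hd0⟩)
    + lam ⟨1, hd1⟩ * d / lam ⟨0, hd0⟩ := ⟨_, rfl⟩
  obtain ⟨B2, hB2⟩ : ∃ B2, B2 = lam ⟨1, hd1⟩ * (1 + exp (lam ⟨0, hd0⟩) * lam ⟨0, hd0⟩) /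
    lam ⟨0, hd0⟩ + 2 * exp (lam ⟨0, hd0⟩) * lam ⟨1, hd1⟩ * lam ⟨0, hd0⟩
      + 2 * CC (lam ⟨0, hd0⟩) := ⟨_, rfl⟩
  obtain ⟨B3, hB3⟩ : ∃ B3, B3 = 1 + exp (lam ⟨0, hd0⟩) * lam ⟨0, hd0⟩ := ⟨_, rfl⟩
  have hB1p : 0 < B1 := by rw [hB1]; positivity
  have hB2p : 0 < B2 := by rw [hB2]; positivity
  have hB3p : 0 < B3 := by rw [hB3]; positivity
  obtain ⟨θ, hθ⟩ : ∃ θ, θ = min (min (γ / B1) (γ / B2)) (1 / (2 * B3)) := ⟨_, rfl⟩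
  have hθp : 0 < θ := by
    rw [hθ]; exact lt_min (lt_min (by positivity) (by positivity)) (by positivity)
  have h1 : θ * B1 ≤ γ := by
    rw [← le_div_iff₀ hB1p, hθ]; exact (min_le_left _ _).trans (min_le_left _ _)
  have h2 : θ * B2 ≤ γ := by
    rw [← le_div_iff₀ hB2p, hθ]; exact (min_le_left _ _).trans (min_le_right _ _)
  have h3 : θ * B3 < 1 := by
    have : θ * (2 * B3) ≤ 1 := by
      rw [← le_div_iff₀ (by positivity), hθ]; exact min_le_right _ _
    have := mul_pos hθp hB3p
    linarith
  obtain ⟨ε₀, hε₀, H⟩ := moments hpos hl hgap hle2 hω hθp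
  refine ⟨ε₀, hε₀, fun ε hε hlt μ hμ => ?_⟩
  obtain ⟨s, hs, hT, hm, hX⟩ := H ε hε hlt μ hμ
  have := hμ.1
  refine ⟨fun h hmeas hh2 h0 => ?_, ?_⟩
  · exact part_i hpos hl hgap hle2 hε hθp hs μ hT hX (hB1 ▸ h1) hmeas hh2 h0
  · have hXX := hX _ hi _ hi
    rw [if_pos rfl, mul_one] at hXX
    exact part_ii hpos hi hle hε hs μ hT (hm _ hi) hXX (hB2 ▸ h2) (hB3 ▸ h3)

end
end

section
/- There exist constants C > 0 and ε₀ ∈ (0,1) such that for every 0 < ε < ε₀, every η ≥ 0, and every Borel probability measure μ on S with E_{ε,A}(μ) ≤ m_ε + η, one has I_A(μ) ≥ e^{λ_1} − C·ε·log(1/ε) − 2η. -/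
open MeasureTheory Real Filter Topology

noncomputable section

variable {d : ℕ}

lemma measurable_sphMap (g : EuclideanSpace ℝ (Fin d) ≃ₗᵢ[ℝ] EuclideanSpace ℝ (Fin d)) :
    Measurable (sphMap g) := by
  apply Continuous.measurable
  unfold sphMap
  exact Continuous.subtype_mk (g.continuous.comp continuous_subtype_val) _

lemma ball_const (ω : Measure (Sph d)) (hω : IsUniform ω) (x y : Sph d) (r : ℝ) :
    ω (Metric.ball x r) = ω (Metric.ball y r) := by
  have hx : ‖(x : EuclideanSpace ℝ (Fin d))‖ = 1 := mem_sphere_zero_iff_norm.1 x.2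
  have hy : ‖(y : EuclideanSpace ℝ (Fin d))‖ = 1 := mem_sphere_zero_iff_norm.1 y.2
  let g : EuclideanSpace ℝ (Fin d) ≃ₗᵢ[ℝ] EuclideanSpace ℝ (Fin d) :=
    (Submodule.reflection (ℝ ∙ ((x : EuclideanSpace ℝ (Fin d)) - y))ᗮ)
  have hg : g x = y := Submodule.reflection_sub (hx.trans hy.symm)
  have h := hω.2 g
  conv_rhs => rw [← h]
  rw [Measure.map_apply (measurable_sphMap g) Metric.isOpen_ball.measurableSet]
  congr 1
  ext z
  simp only [Metric.mem_ball, Set.mem_preimage, Subtype.dist_eq, sphMap]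
  rw [← hg, g.dist_map]

lemma ball_lower (ω : Measure (Sph d)) (hω : IsUniform ω) (e : Sph d) (r : ℝ) (hr : 0 < r)
    (hr1 : r ≤ 1) :
    ENNReal.ofReal ((r / 2) ^ d) ≤ ω (Metric.ball e (2 * r)) := by
  haveI := hω.1
  let E := EuclideanSpace ℝ (Fin d)
  let s : Set (Sph d × E) := {p | dist (p.1 : E) p.2 < r}
  have hs : MeasurableSet s := by
    apply IsOpen.measurableSet
    apply isOpen_lt _ continuous_const
    fun_prop
  have hV0 : (volume : Measure E) (Metric.ball 0 1) ≠ 0 :=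
    (Metric.measure_ball_pos _ _ one_pos).ne'
  have hVt : (volume : Measure E) (Metric.ball 0 1) ≠ ⊤ := measure_ball_lt_top.ne
  have h1 : (ω.prod (volume : Measure E)) s
      = ENNReal.ofReal (r ^ d) * (volume : Measure E) (Metric.ball 0 1) := by
    rw [Measure.prod_apply hs]
    have : ∀ x : Sph d, (volume : Measure E) (Prod.mk x ⁻¹' s)
        = ENNReal.ofReal (r ^ d) * (volume : Measure E) (Metric.ball 0 1) := by
      intro x
      have h := Measure.addHaar_ball_of_pos (volume : Measure E) (x : E) hr
      rw [finrank_euclideanSpace_fin] at h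
      rw [← h]
      congr 1
      ext z
      simp [s, dist_comm]
    simp [this]
  have h2 : (ω.prod (volume : Measure E)) s
      ≤ ω (Metric.ball e (2 * r)) *
        (ENNReal.ofReal (2 ^ d) * (volume : Measure E) (Metric.ball 0 1)) := by
    rw [Measure.prod_apply_symm hs]
    have h := Measure.addHaar_ball_of_pos (volume : Measure E) (0 : E) (r := 2) two_pos
    rw [finrank_euclideanSpace_fin] at h
    rw [← h]
    calc _ ≤ ∫⁻ y, (Metric.ball (0 : E) 2).indicator
              (fun _ => ω (Metric.ball e (2 * r))) y ∂(volume : Measure E) := by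
            apply lintegral_mono
            intro y
            rcases Set.eq_empty_or_nonempty ((fun x => (x, y)) ⁻¹' s) with h0 | ⟨x0, hx0⟩
            · simp [h0]
            · have hx0' : dist (x0 : E) y < r := hx0
              have hy : y ∈ Metric.ball (0 : E) 2 := by
                have hx : ‖(x0 : E)‖ = 1 := mem_sphere_zero_iff_norm.1 x0.2
                rw [Metric.mem_ball, dist_zero_right]
                have := norm_sub_norm_le y (x0 : E)
                rw [← dist_eq_norm, dist_comm] at this
                linarith
              simp only [Set.indicator_of_mem hy]
              rw [ball_const ω hω e x0]
              apply measure_mono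
              intro x hx
              have hx' : dist (x : E) y < r := hx
              rw [Metric.mem_ball, Subtype.dist_eq]
              have := dist_triangle_right (x : E) x0 y
              linarith
      _ = _ := by
            rw [lintegral_indicator_const Metric.isOpen_ball.measurableSet]
  rw [h1, ← mul_assoc] at h2
  have h3 := (ENNReal.mul_le_mul_iff_left hV0 hVt).1 h2
  rw [div_pow, ENNReal.ofReal_div_of_pos (by positivity)]
  exact ENNReal.div_le_of_le_mul h3

lemma Ent_nonneg (ω μ : Measure (Sph d)) [IsProbabilityMeasure ω] [IsProbabilityMeasure μ] :
    0 ≤ Ent ω μ := by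
  unfold Ent
  split_ifs with h
  · have := InformationTheory.integral_llr_add_sub_measure_univ_nonneg h.1 h.2
    simp only [probReal_univ, llr_def, add_sub_cancel_right] at this
    exact_mod_cast this
  · exact le_top

lemma Ent_cond (ω : Measure (Sph d)) [IsProbabilityMeasure ω] (B : Set (Sph d))
    (hB : MeasurableSet B) (h0 : ω B ≠ 0) :
    Ent ω (ProbabilityTheory.cond ω B) = ((-Real.log (ω B).toReal : ℝ) : EReal) := by
  set ν := ProbabilityTheory.cond ω B with hν
  haveI : IsProbabilityMeasure ν := ProbabilityTheory.cond_isProbabilityMeasure h0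
  have hac : ν ≪ ω := ProbabilityTheory.cond_absolutelyContinuous
  have hden : ν = ω.withDensity (B.indicator (fun _ => (ω B)⁻¹)) := by
    rw [withDensity_indicator hB, withDensity_const]
    rfl
  have hae : (fun x => Real.log (ν.rnDeriv ω x).toReal) =ᵐ[ν]
      fun _ => -Real.log (ω B).toReal := by
    have h1 : ν.rnDeriv ω =ᵐ[ω] B.indicator (fun _ => (ω B)⁻¹) := by
      conv_lhs => rw [hden]
      exact Measure.rnDeriv_withDensity ω (measurable_const.indicator hB)
    have h2 : ∀ᵐ x ∂ν, x ∈ B := ProbabilityTheory.ae_cond_mem hB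
    filter_upwards [hac.ae_le h1, h2] with x hx hxB
    rw [hx, Set.indicator_of_mem hxB, ENNReal.toReal_inv, Real.log_inv]
  unfold Ent
  rw [if_pos ⟨hac, (integrable_const _).congr hae.symm⟩, integral_congr_ae hae]
  simp

lemma continuous_K (lam : Fin d → ℝ) :
    Continuous (fun p : Sph d × Sph d => Kker lam p.1 p.2) := by
  unfold Kker qA
  fun_prop

lemma IA_lower (lam : Fin d → ℝ) (ν : Measure (Sph d)) [IsProbabilityMeasure ν]
    (B : Set (Sph d)) (hB : ∀ᵐ x ∂ν, x ∈ B) (c : ℝ)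
    (hc : ∀ x ∈ B, ∀ y ∈ B, c ≤ Kker lam x y) : c ≤ IA lam ν := by
  have hint : Integrable (fun p : Sph d × Sph d => Kker lam p.1 p.2) (ν.prod ν) :=
    (continuous_K lam).integrable_of_hasCompactSupport (HasCompactSupport.of_compactSpace _)
  have hc1 : ∀ x ∈ B, c ≤ ∫ y, Kker lam x y ∂ν := by
    intro x hx
    have hi : Integrable (fun y => Kker lam x y) ν :=
      ((continuous_K lam).comp (Continuous.prodMk_right x)).integrable_of_hasCompactSupport
        (HasCompactSupport.of_compactSpace _)
    have := integral_mono_ae (integrable_const c) hi (by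
      filter_upwards [hB] with y hy using hc x hx y hy)
    simpa using this
  have := integral_mono_ae (integrable_const c) hint.integral_prod_left (by
      filter_upwards [hB] with x hx using hc1 x hx)
  simpa [IA] using this

lemma q_lower (lam : Fin d → ℝ) (hpos : ∀ i, 0 < lam i) (e x y : Sph d) (r : ℝ)
    (hx : dist x e ≤ r) (hy : dist y e ≤ r) :
    qA lam e e - 2 * (∑ i, lam i) * r ≤ qA lam x y := by
  have hco : ∀ (v : EuclideanSpace ℝ (Fin d)) (i : Fin d), |v i| ≤ ‖v‖ := fun v i =>
    PiLp.norm_apply_le v i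
  have hr : 0 ≤ r := dist_nonneg.trans hx
  rw [sub_le_iff_le_add, ← sub_le_iff_le_add']
  unfold qA
  rw [Finset.mul_sum, Finset.sum_mul, ← Finset.sum_sub_distrib]
  apply Finset.sum_le_sum
  intro i _
  have h1 : |(x : EuclideanSpace ℝ (Fin d)) i - (e : EuclideanSpace ℝ (Fin d)) i| ≤ r := by
    rw [Subtype.dist_eq, dist_eq_norm] at hx
    exact (hco _ i).trans hx
  have h2 : |(y : EuclideanSpace ℝ (Fin d)) i - (e : EuclideanSpace ℝ (Fin d)) i| ≤ r := by
    rw [Subtype.dist_eq, dist_eq_norm] at hy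
    exact (hco _ i).trans hy
  have h3 : |(y : EuclideanSpace ℝ (Fin d)) i| ≤ 1 :=
    (hco _ i).trans (mem_sphere_zero_iff_norm.1 y.2).le
  have h4 : |(e : EuclideanSpace ℝ (Fin d)) i| ≤ 1 :=
    (hco _ i).trans (mem_sphere_zero_iff_norm.1 e.2).le
  generalize (x : EuclideanSpace ℝ (Fin d)) i = a at *
  generalize (y : EuclideanSpace ℝ (Fin d)) i = b at *
  generalize (e : EuclideanSpace ℝ (Fin d)) i = c at *
  have h5 : |(a - c) * b| ≤ r * 1 := by
    rw [abs_mul]; exact mul_le_mul h1 h3 (abs_nonneg _) hr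
  have h6 : |c * (b - c)| ≤ 1 * r := by
    rw [abs_mul]; exact mul_le_mul h4 h2 (abs_nonneg _) zero_le_one
  have h7 := neg_le_of_abs_le h5
  have h8 := neg_le_of_abs_le h6
  have h9 := mul_le_mul_of_nonneg_left (show c * c - a * b ≤ 2 * r by nlinarith) (hpos i).le
  nlinarith

/-- near-minimal free energy forces near-maximal interaction energy. -/
theorem stmt12 (d : ℕ) (hd : 2 ≤ d) (lam : Fin d → ℝ)
    (hanti : Antitone lam)
    (hgap : lam ⟨1, by omega⟩ < lam ⟨0, by omega⟩)
    (hpos : ∀ i, 0 < lam i)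
    (ω : Measure (Sph d)) (hω : IsUniform ω) :
    ∃ C : ℝ, 0 < C ∧ ∃ ε₀ : ℝ, 0 < ε₀ ∧ ε₀ < 1 ∧ ∀ ε : ℝ, 0 < ε → ε < ε₀ →
      ∀ η : ℝ, 0 ≤ η →
      ∀ μ : Measure (Sph d), IsProbabilityMeasure μ →
        EA lam ω ε μ ≤ mEps lam ω ε + ((η : ℝ) : EReal) →
        Real.exp (lam ⟨0, by omega⟩) - C * ε * Real.log (1 / ε) - 2 * η ≤ IA lam μ := by
  haveI := hω.1
  set L := lam ⟨0, by omega⟩ with hL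
  let e : Sph d := ⟨EuclideanSpace.single ⟨0, by omega⟩ (1 : ℝ), by simp⟩
  have hqe : qA lam e e = L := by
    simp [qA, e, hL, Finset.sum_ite_eq]
  set M := ∑ i, lam i with hM
  have hM0 : 0 ≤ M := Finset.sum_nonneg fun i _ => (hpos i).le
  have hexp : 0 < Real.exp L := Real.exp_pos _
  have hlog4 : 0 ≤ Real.log 4 := Real.log_nonneg (by norm_num)
  have hd0 : (0 : ℝ) < d := by exact_mod_cast (by omega : 0 < d)
  refine ⟨Real.exp L * (2 * M) + 2 * d * (Real.log 4 + 1), by positivity, 1 / 4, by norm_num,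
    by norm_num, ?_⟩
  intro ε hε hε4 η hη μ hμ hE
  have hl1 : 1 ≤ Real.log (1 / ε) := by
    rw [Real.le_log_iff_exp_le (by positivity), le_div_iff₀ hε]
    have := Real.exp_one_lt_d9
    nlinarith
  let B := Metric.ball e ε
  have hBm : MeasurableSet B := Metric.isOpen_ball.measurableSet
  have hBl : ENNReal.ofReal ((ε / 4) ^ d) ≤ ω B := by
    have := ball_lower ω hω e (ε / 2) (by linarith) (by linarith)
    rw [show ε / 2 / 2 = ε / 4 by ring, show 2 * (ε / 2) = ε by ring] at this
    exact this
  have hp : (0 : ℝ) < (ε / 4) ^ d := by positivity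
  have hB0 : ω B ≠ 0 := ((ENNReal.ofReal_pos.2 hp).trans_le hBl).ne'
  let ν := ProbabilityTheory.cond ω B
  haveI hν : IsProbabilityMeasure ν := ProbabilityTheory.cond_isProbabilityMeasure hB0
  have hlogB : -Real.log (ω B).toReal ≤ d * (Real.log 4 + Real.log (1 / ε)) := by
    have h1 : (ε / 4) ^ d ≤ (ω B).toReal :=
      (ENNReal.ofReal_le_iff_le_toReal (measure_ne_top _ _)).1 hBl
    have h2 := Real.log_le_log hp h1
    rw [Real.log_pow, Real.log_div hε.ne' (by norm_num)] at h2
    rw [one_div, Real.log_inv]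
    linarith
  have hI : Real.exp L - Real.exp L * (2 * M) * ε ≤ IA lam ν := by
    apply IA_lower lam ν B (ProbabilityTheory.ae_cond_mem hBm)
    intro x hx y hy
    have h1 := q_lower lam hpos e x y ε (Metric.mem_ball.1 hx).le (Metric.mem_ball.1 hy).le
    rw [hqe, ← hM] at h1
    unfold Kker
    refine le_trans ?_ (Real.exp_le_exp.2 h1)
    have h2 := Real.add_one_le_exp (-(2 * M * ε))
    rw [sub_eq_add_neg L, Real.exp_add]
    nlinarith
  have hEν : EA lam ω ε ν = ((ε * (-Real.log (ω B).toReal) - IA lam ν / 2 : ℝ) : EReal) := by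
    unfold EA
    rw [Ent_cond ω B hBm hB0]
    norm_cast
  have hm : mEps lam ω ε ≤ EA lam ω ε ν := sInf_le ⟨ν, hν, rfl⟩
  have hlow : ((-(IA lam μ / 2) : ℝ) : EReal) ≤ EA lam ω ε μ := by
    unfold EA
    have := EReal.sub_le_sub (EReal.mul_nonneg (EReal.coe_nonneg.2 hε.le) (Ent_nonneg ω μ))
      (le_refl ((IA lam μ / 2 : ℝ) : EReal))
    refine le_trans (le_of_eq ?_) this
    rw [zero_sub, EReal.coe_neg]
  have hfin : ((-(IA lam μ / 2) : ℝ) : EReal)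
      ≤ ((ε * (-Real.log (ω B).toReal) - IA lam ν / 2 + η : ℝ) : EReal) := by
    rw [EReal.coe_add, ← hEν]
    exact hlow.trans (hE.trans (add_le_add_left hm _))
  rw [EReal.coe_le_coe_iff] at hfin
  have k1 := mul_le_mul_of_nonneg_left hlogB hε.le
  have k2 : ε ≤ ε * Real.log (1 / ε) := by nlinarith
  have k3 := mul_le_mul_of_nonneg_left k2 (show 0 ≤ Real.exp L * (2 * M) by positivity)
  have k4 := mul_le_mul_of_nonneg_left k2 (show 0 ≤ 2 * d * Real.log 4 by positivity)
  nlinarith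

end
end
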